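/- arXiv:2502.02064 — 2 statements merged into one kernel-verified Lean document; each statement's English description precedes it below -/
import Mathlib

section
/- Let φ : ℝ⁺ → ℝ⁺ be an increasing function such that log φ is a regularly increasing function with index ρ, where 1 < ρ ≤ ∞ (index ∞ meaning that x·(log φ)'(x)/log φ(x) → ∞ as x → ∞). Then the Hausdorff dimension of L(φ) equals 1/(1+β), where β = limsup_{n→∞} [log φ(n+1) + log φ(n−1) + ⋯ + log φ(n+1−2⌊n/2⌋)] / [log φ(n) + log φ(n−2) + ⋯ + log φ(n−2⌊(n−1)/2⌋)]. -/
open Filter Set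
open scoped ENNReal

/-- The Gauss map. -/
noncomputable def gaussMap (x : ℝ) : ℝ := Int.fract (1 / x)

/-- The `n`-th partial quotient `a_n(x)` (for `n ≥ 1`) of the continued fraction
expansion of `x ∈ (0,1)`. -/
noncomputable def pq (x : ℝ) (n : ℕ) : ℕ := ⌊1 / (gaussMap^[n - 1] x)⌋₊

/-- `L_n(x) = max_{1 ≤ i ≤ n} a_i(x) a_{i+1}(x)`. -/
noncomputable def Lmax (x : ℝ) (n : ℕ) : ℕ :=
  (Finset.Icc 1 n).sup fun i => pq x i * pq x (i + 1)

/-- The level set `L(φ)` of irrational `x ∈ (0,1)` with `L_n(x)/φ(n) → 1`. -/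
def Lset (φ : ℕ → ℝ) : Set ℝ :=
  {x | x ∈ Ioo (0 : ℝ) 1 ∧ Irrational x ∧
    Tendsto (fun n => (Lmax x n : ℝ) / φ n) atTop (nhds 1)}

/-- `f` is regularly increasing with (finite) index `ρ`. -/
def RegInc (f : ℝ → ℝ) (ρ : ℝ) : Prop :=
  ∃ c > (0 : ℝ), ∃ f' : ℝ → ℝ,
    (∀ x ∈ Ici c, 0 < f x) ∧
    (∀ x ∈ Ici c, HasDerivAt f (f' x) x) ∧
    ContinuousOn f' (Ici c) ∧
    (∀ x ∈ Ici c, 0 < f' x) ∧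
    Tendsto f atTop atTop ∧
    Tendsto (fun x => x * f' x / f x) atTop (nhds ρ)

/-- `f` is regularly increasing with index `∞`. -/
def RegIncTop (f : ℝ → ℝ) : Prop :=
  ∃ c > (0 : ℝ), ∃ f' : ℝ → ℝ,
    (∀ x ∈ Ici c, 0 < f x) ∧
    (∀ x ∈ Ici c, HasDerivAt f (f' x) x) ∧
    ContinuousOn f' (Ici c) ∧
    (∀ x ∈ Ici c, 0 < f' x) ∧
    Tendsto f atTop atTop ∧
    Tendsto (fun x => x * f' x / f x) atTop atTop

/-- The constant `β` of Theorem 1.2 (3):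
`β = limsup_n [log φ(n+1) + log φ(n-1) + ⋯ + log φ(n+1-2⌊n/2⌋)] /
             [log φ(n) + log φ(n-2) + ⋯ + log φ(n-2⌊(n-1)/2⌋)]`. -/
noncomputable def betaVal (φ : ℝ → ℝ) : ℝ≥0∞ :=
  Filter.limsup (fun n : ℕ =>
    ENNReal.ofReal
      ((∑ j ∈ Finset.range (n / 2 + 1), Real.log (φ ((n + 1 - 2 * j : ℕ) : ℝ))) /
       (∑ j ∈ Finset.range ((n - 1) / 2 + 1), Real.log (φ ((n - 2 * j : ℕ) : ℝ))))) atTop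

/-! ### The Gauss map and partial quotients -/

lemma pq_succ (x : ℝ) (i : ℕ) : pq x (i + 1) = ⌊1 / gaussMap^[i] x⌋₊ := by
  simp [pq]

lemma gaussMap_mem_of_irrational {x : ℝ} (hx : Irrational x) :
    gaussMap x ∈ Ioo (0 : ℝ) 1 ∧ Irrational (gaussMap x) := by
  have h : Irrational (gaussMap x) := by
    have h1 : Irrational (1 / x) := by simpa using hx.inv
    have : gaussMap x = 1 / x - (⌊1 / x⌋ : ℤ) := rfl
    rw [this]
    exact h1.sub_intCast _
  exact ⟨⟨lt_of_le_of_ne (Int.fract_nonneg _) (fun h0 => h.ne_zero h0.symm), Int.fract_lt_one _⟩, h⟩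

lemma orbit_mem {x : ℝ} (hx : x ∈ Ioo (0 : ℝ) 1) (hi : Irrational x) (i : ℕ) :
    gaussMap^[i] x ∈ Ioo (0 : ℝ) 1 ∧ Irrational (gaussMap^[i] x) := by
  induction i with
  | zero => exact ⟨hx, hi⟩
  | succ n ih =>
    rw [Function.iterate_succ_apply']
    exact gaussMap_mem_of_irrational ih.2

lemma inv_orbit {x : ℝ} (hx : x ∈ Ioo (0 : ℝ) 1) (hi : Irrational x) (i : ℕ) :
    1 / gaussMap^[i] x = pq x (i + 1) + gaussMap^[i + 1] x := by
  rw [Function.iterate_succ_apply', pq_succ, gaussMap,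
    natCast_floor_eq_intCast_floor (by have := (orbit_mem hx hi i).1.1; positivity)]
  exact (Int.floor_add_fract _).symm

lemma one_le_pq {x : ℝ} (hx : x ∈ Ioo (0 : ℝ) 1) (hi : Irrational x) (i : ℕ) :
    1 ≤ pq x (i + 1) := by
  rw [pq_succ]
  have h := (orbit_mem hx hi i).1
  refine Nat.le_floor ?_
  rw [Nat.cast_one]
  exact (one_lt_one_div h.1 h.2).le

lemma orbit_le {x : ℝ} (hx : x ∈ Ioo (0 : ℝ) 1) (hi : Irrational x) (i : ℕ) :
    gaussMap^[i] x ≤ 1 / (pq x (i + 1) : ℝ) := by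
  have h := (orbit_mem hx hi i).1.1
  have h1 : (1 : ℝ) ≤ pq x (i + 1) := by exact_mod_cast one_le_pq hx hi i
  rw [le_one_div h (by linarith), inv_orbit hx hi i]
  linarith [(orbit_mem hx hi (i + 1)).1.1]

lemma le_orbit {x : ℝ} (hx : x ∈ Ioo (0 : ℝ) 1) (hi : Irrational x) (i : ℕ) :
    1 / (pq x (i + 1) + 1 : ℝ) ≤ gaussMap^[i] x := by
  have h := (orbit_mem hx hi i).1.1
  rw [one_div_le (by positivity) h, inv_orbit hx hi i]
  linarith [(orbit_mem hx hi (i + 1)).1.2]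

lemma abs_orbit_sub {x y : ℝ} (hx : x ∈ Ioo (0 : ℝ) 1) (hxi : Irrational x)
    (hy : y ∈ Ioo (0 : ℝ) 1) (hyi : Irrational y) (i : ℕ) :
    |gaussMap^[i] x - gaussMap^[i] y| = gaussMap^[i] x * gaussMap^[i] y *
      |((pq x (i + 1) : ℝ) - pq y (i + 1)) + (gaussMap^[i + 1] x - gaussMap^[i + 1] y)| := by
  have h1 := (orbit_mem hx hxi i).1.1
  have h2 := (orbit_mem hy hyi i).1.1
  have e : ((pq x (i + 1) : ℝ) - pq y (i + 1)) + (gaussMap^[i + 1] x - gaussMap^[i + 1] y)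
      = 1 / gaussMap^[i] x - 1 / gaussMap^[i] y := by
    rw [inv_orbit hx hxi i, inv_orbit hy hyi i]; ring
  rw [e, ← abs_of_pos (mul_pos h1 h2), ← abs_mul, abs_sub_comm]
  congr 1
  field_simp

/-- Points whose first `n` partial quotients agree. -/
lemma abs_sub_eq_prod {x y : ℝ} (hx : x ∈ Ioo (0 : ℝ) 1) (hxi : Irrational x)
    (hy : y ∈ Ioo (0 : ℝ) 1) (hyi : Irrational y) (n : ℕ)
    (h : ∀ i < n, pq x (i + 1) = pq y (i + 1)) :
    |x - y| = (∏ i ∈ Finset.range n, gaussMap^[i] x * gaussMap^[i] y) *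
      |gaussMap^[n] x - gaussMap^[n] y| := by
  induction n with
  | zero => simp
  | succ n ih =>
    rw [ih fun i hi => h i (by omega), Finset.prod_range_succ, abs_orbit_sub hx hxi hy hyi n,
      h n (by omega), sub_self, zero_add]
    ring

lemma ne_ratCast_of_orbit_pos (q : ℚ) (h : ∀ i, 0 < gaussMap^[i] (q : ℝ)) : False := by
  induction hn : q.num.toNat using Nat.strong_induction_on generalizing q with
  | _ n ih =>
    have hq : 0 < q := by simpa using h 0
    have e : gaussMap (q : ℝ) = ((Int.fract q⁻¹ : ℚ) : ℝ) := by
      simp [gaussMap, Rat.cast_fract]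
    have h1 := Rat.fract_inv_num_lt_num_of_pos hq
    refine ih (Int.fract q⁻¹).num.toNat ?_ (Int.fract q⁻¹) (fun i => ?_) rfl
    · have := Rat.num_pos.mpr hq
      omega
    · rw [← e, ← Function.iterate_succ_apply]
      exact h (i + 1)

/-- The finite continued fraction `[a 0, …, a (n - 1)]`. -/
noncomputable def cfApprox : ℕ → (ℕ → ℕ) → ℝ
  | 0, _ => 0
  | n + 1, a => 1 / (a 0 + cfApprox n fun i => a (i + 1))

lemma cfApprox_mem (n : ℕ) (a : ℕ → ℕ) (ha : ∀ i, 2 ≤ a i) :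
    cfApprox n a ∈ Icc (0 : ℝ) (1 / 2) := by
  induction n generalizing a with
  | zero => simp [cfApprox]
  | succ n ih =>
    have h := ih (fun i => a (i + 1)) fun i => ha _
    have h0 : (2 : ℝ) ≤ a 0 := by exact_mod_cast ha 0
    rw [cfApprox]
    constructor
    · have := h.1
      positivity
    · exact one_div_le_one_div_of_le (by norm_num) (by linarith [h.1])

lemma dist_cfApprox_succ (n : ℕ) (a : ℕ → ℕ) (ha : ∀ i, 2 ≤ a i) :
    dist (cfApprox n a) (cfApprox (n + 1) a) ≤ 1 / 2 * (1 / 4) ^ n := by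
  induction n generalizing a with
  | zero =>
    have h := cfApprox_mem 1 a ha
    rw [Real.dist_eq, show cfApprox 0 a = 0 from rfl, zero_sub, abs_neg, abs_of_nonneg h.1]
    simpa using h.2
  | succ n ih =>
    have h := ih (fun i => a (i + 1)) fun i => ha _
    have h1 := cfApprox_mem n (fun i => a (i + 1)) fun i => ha _
    have h2 := cfApprox_mem (n + 1) (fun i => a (i + 1)) fun i => ha _
    have h0 : (2 : ℝ) ≤ a 0 := by exact_mod_cast ha 0
    rw [cfApprox, cfApprox.eq_2 a (n + 1), Real.dist_eq]
    rw [Real.dist_eq] at h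
    generalize cfApprox n (fun i => a (i + 1)) = u at *
    generalize cfApprox (n + 1) (fun i => a (i + 1)) = v at *
    have hu : 2 ≤ a 0 + u := by linarith [h1.1]
    have hv : 2 ≤ a 0 + v := by linarith [h2.1]
    have e : 1 / ((a 0 : ℝ) + u) - 1 / (a 0 + v) = (v - u) / ((a 0 + u) * (a 0 + v)) := by
      field_simp
      ring
    rw [e, abs_div, abs_sub_comm, abs_of_pos (by positivity : 0 < ((a 0 : ℝ) + u) * (a 0 + v)),
      div_le_iff₀ (by positivity)]
    calc |u - v| ≤ 1 / 2 * (1 / 4) ^ n := h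
      _ = 1 / 2 * (1 / 4) ^ (n + 1) * (2 * 2) := by ring
      _ ≤ _ := by gcongr

/-- The infinite continued fraction with partial quotients `a 0, a 1, …`. -/
noncomputable def cfLim (a : ℕ → ℕ) : ℝ := limUnder atTop fun n => cfApprox n a

lemma tendsto_cfApprox (a : ℕ → ℕ) (ha : ∀ i, 2 ≤ a i) :
    Tendsto (fun n => cfApprox n a) atTop (nhds (cfLim a)) :=
  (cauchySeq_of_le_geometric (1 / 4) (1 / 2) (by norm_num)
    fun n => dist_cfApprox_succ n a ha).tendsto_limUnder

lemma cfLim_eq (a : ℕ → ℕ) (ha : ∀ i, 2 ≤ a i) :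
    cfLim a = 1 / (a 0 + cfLim fun i => a (i + 1)) := by
  have h0 : (2 : ℝ) ≤ a 0 := by exact_mod_cast ha 0
  have h1 := tendsto_cfApprox (fun i => a (i + 1)) fun i => ha _
  have h2 := ge_of_tendsto' h1 fun n => (cfApprox_mem n _ fun i => ha _).1
  refine tendsto_nhds_unique ((tendsto_add_atTop_iff_nat 1).2 (tendsto_cfApprox a ha)) ?_
  exact tendsto_const_nhds.div (tendsto_const_nhds.add h1) (by linarith)

lemma cfLim_mem (a : ℕ → ℕ) (ha : ∀ i, 2 ≤ a i) : 0 < cfLim a ∧ cfLim a ≤ 1 / 2 := by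
  have h (a : ℕ → ℕ) (ha : ∀ i, 2 ≤ a i) : 0 ≤ cfLim a ∧ cfLim a ≤ 1 / 2 :=
    ⟨ge_of_tendsto' (tendsto_cfApprox a ha) fun n => (cfApprox_mem n a ha).1,
      le_of_tendsto' (tendsto_cfApprox a ha) fun n => (cfApprox_mem n a ha).2⟩
  refine ⟨?_, (h a ha).2⟩
  rw [cfLim_eq a ha]
  have h0 : (2 : ℝ) ≤ a 0 := by exact_mod_cast ha 0
  have := (h (fun i => a (i + 1)) fun i => ha _).1
  positivity

lemma inv_cfLim (a : ℕ → ℕ) (ha : ∀ i, 2 ≤ a i) :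
    1 / cfLim a = a 0 + cfLim fun i => a (i + 1) := by
  rw [cfLim_eq a ha, one_div_one_div]

lemma gaussMap_cfLim (a : ℕ → ℕ) (ha : ∀ i, 2 ≤ a i) :
    gaussMap (cfLim a) = cfLim fun i => a (i + 1) := by
  have h := cfLim_mem (fun i => a (i + 1)) fun i => ha _
  rw [gaussMap, inv_cfLim a ha, Int.fract_natCast_add, Int.fract_eq_self]
  constructor <;> linarith

lemma orbit_cfLim (a : ℕ → ℕ) (ha : ∀ i, 2 ≤ a i) (i : ℕ) :
    gaussMap^[i] (cfLim a) = cfLim fun j => a (j + i) := by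
  induction i with
  | zero => simp
  | succ n ih =>
    rw [Function.iterate_succ_apply', ih, gaussMap_cfLim _ fun i => ha _]
    simp only [add_assoc, add_comm 1 n]

lemma pq_cfLim (a : ℕ → ℕ) (ha : ∀ i, 2 ≤ a i) (i : ℕ) : pq (cfLim a) (i + 1) = a i := by
  have h := cfLim_mem (fun j => a (j + 1 + i)) fun i => ha _
  rw [pq_succ, orbit_cfLim a ha, inv_cfLim _ fun i => ha _, zero_add,
    Nat.floor_eq_iff (by linarith [h.1, (a i).cast_nonneg (α := ℝ)])]
  constructor <;> linarith

lemma irrational_cfLim (a : ℕ → ℕ) (ha : ∀ i, 2 ≤ a i) : Irrational (cfLim a) := by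
  rintro ⟨q, hq⟩
  refine ne_ratCast_of_orbit_pos q fun i => ?_
  rw [hq, orbit_cfLim a ha]
  exact (cfLim_mem _ fun i => ha _).1

/-! ### The reference sequence -/

/-- The sequence `b` with `b 0 = 0` and `b n + b (n + 1) = ψ (n + 1)`. -/
noncomputable def altSum (ψ : ℕ → ℝ) : ℕ → ℝ
  | 0 => 0
  | n + 1 => ψ (n + 1) - altSum ψ n

lemma exists_bound_of_eventually {u : ℕ → ℝ} {Q : ℝ} (h : ∀ᶠ n in atTop, u n ≤ Q) :
    ∃ Q', ∀ n, u n ≤ Q' := by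
  obtain ⟨N, hN⟩ := eventually_atTop.1 h
  obtain ⟨M, hM⟩ := ((Finset.range N).image u).exists_le
  refine ⟨max M Q, fun n => ?_⟩
  rcases lt_or_ge n N with h | h
  · exact le_max_of_le_left (hM _ (Finset.mem_image_of_mem _ (by simpa using h)))
  · exact le_max_of_le_right (hN n h)

lemma exists_lower_bound_of_step_two {u : ℕ → ℝ} (h : ∀ᶠ n in atTop, u n ≤ u (n + 2)) :
    ∃ D, ∀ n, -D ≤ u n := by
  obtain ⟨N, hN⟩ := eventually_atTop.1 h
  have key : ∀ n, N ≤ n → min (u N) (u (N + 1)) ≤ u n ∧ min (u N) (u (N + 1)) ≤ u (n + 1) := by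
    intro n hn
    induction n, hn using Nat.le_induction with
    | base => exact ⟨min_le_left _ _, min_le_right _ _⟩
    | succ n hn ih => exact ⟨ih.2, ih.1.trans (hN n hn)⟩
  obtain ⟨Q, hQ⟩ := exists_bound_of_eventually (u := fun n => -u n) (Q := -min (u N) (u (N + 1)))
    (eventually_atTop.2 ⟨N, fun n hn => neg_le_neg (key n hn).1⟩)
  exact ⟨Q, fun n => by linarith [hQ n]⟩

lemma altSum_superlinear {ψ : ℕ → ℝ}
    (h : Tendsto (fun n => ψ (n + 1) - ψ n) atTop atTop) (K : ℝ) :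
    ∃ D, ∀ n : ℕ, K * n - D ≤ altSum ψ n := by
  obtain ⟨D, hD⟩ := exists_lower_bound_of_step_two (u := fun n : ℕ => altSum ψ n - K * n) (by
    filter_upwards [((tendsto_add_atTop_iff_nat 1).2 h).eventually_ge_atTop (2 * K)] with n hn
    rw [altSum, altSum]
    push_cast
    linarith)
  exact ⟨D, fun n => by linarith [hD n]⟩

lemma sum_superquadratic {b : ℕ → ℝ} (hb : ∀ K, ∃ D, ∀ n : ℕ, K * n - D ≤ b n) (K : ℝ) :
    ∃ D, ∀ n : ℕ, K * (n : ℝ) ^ 2 - D ≤ ∑ i ∈ Finset.range n, b i := by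
  obtain ⟨E, hE⟩ := hb (2 * |K| + 1)
  obtain ⟨D, hD⟩ := exists_lower_bound_of_step_two
    (u := fun n : ℕ => ∑ i ∈ Finset.range n, b i - K * (n : ℝ) ^ 2) (by
    filter_upwards [(tendsto_natCast_atTop_atTop (R := ℝ)).eventually_ge_atTop (2 * E + 4 * |K|)]
      with n hn
    rw [Finset.sum_range_succ, Finset.sum_range_succ]
    have h1 := hE n
    have h2 := hE (n + 1)
    push_cast at h2 ⊢
    have h3 : K * (n + 1) ≤ |K| * (n + 1) := by gcongr; exact le_abs_self K
    nlinarith [abs_nonneg K])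
  exact ⟨D, fun n => by linarith [hD n]⟩

lemma sum_altSum (ψ : ℕ → ℝ) (n : ℕ) :
    ∑ i ∈ Finset.range (n + 2), altSum ψ i =
      ∑ j ∈ Finset.range (n / 2 + 1), ψ (n + 1 - 2 * j) := by
  induction n using Nat.twoStepInduction with
  | zero => simp [Finset.sum_range_succ, altSum]
  | one => simp [Finset.sum_range_succ, altSum]
  | more n ih _ =>
    rw [Finset.sum_range_succ, Finset.sum_range_succ, ih,
      show (n + 2) / 2 + 1 = n / 2 + 1 + 1 by omega, Finset.sum_range_succ' _ (n / 2 + 1), altSum.eq_2 ψ (n + 2)]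
    have e : ∀ j, n + 2 + 1 - 2 * (j + 1) = n + 1 - 2 * j := fun j => by omega
    simp only [e, mul_zero, Nat.sub_zero]
    ring_nf

/-- For a superquadratic `A` and `δ > 0`, `δ * A n` dominates every multiple of `(n + 1) ^ 2`. -/
lemma superquadratic_dominates {A : ℕ → ℝ}
    (hA : ∀ K, ∃ D, ∀ n : ℕ, K * (n : ℝ) ^ 2 - D ≤ A n) {δ : ℝ} (hδ : 0 < δ) {M : ℝ}
    (hM : 0 ≤ M) : ∃ Q, ∀ n : ℕ, M * ((n : ℝ) + 1) ^ 2 - δ * A n ≤ Q := by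
  obtain ⟨D, hD⟩ := hA (2 * M / δ)
  refine ⟨2 * M + δ * D, fun n => ?_⟩
  have h1 := mul_le_mul_of_nonneg_left (hD n) hδ.le
  have h2 : δ * (2 * M / δ * (n : ℝ) ^ 2 - D) = 2 * M * (n : ℝ) ^ 2 - δ * D := by
    field_simp
  have h3 : 0 ≤ M * ((n : ℝ) - 1) ^ 2 := by positivity
  nlinarith

lemma sum_range_succ_le_sq (n : ℕ) :
    ∑ i ∈ Finset.range n, ((i : ℝ) + 1) ≤ (n : ℝ) ^ 2 := by
  induction n with
  | zero => simp
  | succ n ih =>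
    rw [Finset.sum_range_succ]
    push_cast
    nlinarith [(n.cast_nonneg : (0 : ℝ) ≤ n)]

/-! ### Upper bound -/

/-- Irrational points whose partial quotients deviate from `exp ∘ b` by at most an
exponential factor. -/
def bandSet (b : ℕ → ℝ) (C : ℝ) : Set ℝ :=
  {x | x ∈ Ioo (0 : ℝ) 1 ∧ Irrational x ∧
    ∀ i : ℕ, |Real.log (pq x (i + 1)) - b i| ≤ C * (i + 1)}

lemma pq_bounds_of_mem_bandSet {b : ℕ → ℝ} {C x : ℝ} (hx : x ∈ bandSet b C) (i : ℕ) :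
    Real.exp (b i - C * (i + 1)) ≤ pq x (i + 1) ∧
      (pq x (i + 1) : ℝ) ≤ Real.exp (b i + C * (i + 1)) := by
  have h1 : (0 : ℝ) < pq x (i + 1) := by exact_mod_cast one_le_pq hx.1 hx.2.1 i
  have h2 := abs_le.1 (hx.2.2 i)
  constructor
  · rw [← Real.le_log_iff_exp_le h1]; linarith
  · rw [← Real.log_le_iff_le_exp h1]; linarith

lemma abs_sub_le_of_mem_bandSet {b : ℕ → ℝ} {C x y : ℝ} (hC : 0 ≤ C) (hx : x ∈ bandSet b C)
    (hy : y ∈ bandSet b C) (n : ℕ) (h : ∀ i < n, pq x (i + 1) = pq y (i + 1)) :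
    |x - y| ≤ Real.exp (3 * C * ((n : ℝ) + 1) ^ 2 - (∑ i ∈ Finset.range n, b i +
      ∑ i ∈ Finset.range (n + 1), b i)) := by
  have orb : ∀ z ∈ bandSet b C, ∀ i : ℕ,
      0 < gaussMap^[i] z ∧ gaussMap^[i] z ≤ Real.exp (C * (i + 1) - b i) := by
    intro z hz i
    refine ⟨(orbit_mem hz.1 hz.2.1 i).1.1, (orbit_le hz.1 hz.2.1 i).trans ?_⟩
    rw [show C * ((i : ℝ) + 1) - b i = -(b i - C * (i + 1)) by ring, Real.exp_neg, one_div]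
    exact inv_anti₀ (Real.exp_pos _) (pq_bounds_of_mem_bandSet hz i).1
  rw [abs_sub_eq_prod hx.1 hx.2.1 hy.1 hy.2.1 n h]
  have h1 : ∏ i ∈ Finset.range n, gaussMap^[i] x * gaussMap^[i] y ≤
      Real.exp (∑ i ∈ Finset.range n, 2 * (C * (i + 1) - b i)) := by
    rw [Real.exp_sum]
    refine Finset.prod_le_prod (fun i _ => (mul_pos (orb x hx i).1 (orb y hy i).1).le) fun i _ => ?_
    rw [two_mul, Real.exp_add]
    exact mul_le_mul (orb x hx i).2 (orb y hy i).2 (orb y hy i).1.le (Real.exp_pos _).le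
  have h2 : |gaussMap^[n] x - gaussMap^[n] y| ≤ Real.exp (C * (n + 1) - b n) := by
    rw [abs_le]
    constructor <;> linarith [orb x hx n, orb y hy n]
  refine (mul_le_mul h1 h2 (abs_nonneg _) (Real.exp_pos _).le).trans ?_
  rw [← Real.exp_add, Real.exp_le_exp, ← Finset.mul_sum, Finset.sum_sub_distrib, ← Finset.mul_sum,
    Finset.sum_range_succ]
  have h3 := mul_le_mul_of_nonneg_left (sum_range_succ_le_sq n) hC
  have h4 : 0 ≤ C * n := by positivity
  nlinarith [mul_nonneg hC (sq_nonneg (n : ℝ))]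

lemma dimH_bandSet_le {b : ℕ → ℝ} (hb : ∀ K, ∃ D, ∀ n : ℕ, K * n - D ≤ b n) (s : NNReal) (q : ℝ)
    (hs : 1 < s * (1 + q))
    (hf : ∃ᶠ n in atTop, q * ∑ i ∈ Finset.range n, b i ≤ ∑ i ∈ Finset.range (n + 1), b i)
    (C : ℝ) (hC : 0 ≤ C) : dimH (bandSet b C) ≤ s := by
  have hA := sum_superquadratic hb
  set A : ℕ → ℝ := fun n => ∑ i ∈ Finset.range n, b i with hAdef
  set R : ℕ → ℝ := fun n => Real.exp (3 * C * ((n : ℝ) + 1) ^ 2 - (A n + A (n + 1))) with hR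
  set M : ℕ → ℕ := fun i => ⌊Real.exp (b i + C * (i + 1))⌋₊ with hM
  have hRlim : Tendsto (fun n => ENNReal.ofReal (R n)) atTop (nhds 0) := by
    rw [← ENNReal.ofReal_zero]
    refine ENNReal.tendsto_ofReal (Real.tendsto_exp_atBot.comp ?_)
    obtain ⟨Q, hQ⟩ := superquadratic_dominates hA one_pos (M := 3 * C + 1) (by positivity)
    obtain ⟨D, hD⟩ := hA 0
    have ht : Tendsto (fun n : ℕ => (Q + D) - (n : ℝ)) atTop atBot :=
      tendsto_const_nhds.add_atBot
        (tendsto_neg_atTop_atBot.comp tendsto_natCast_atTop_atTop)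
    refine tendsto_atBot_mono (fun n => ?_) ht
    have h1 := hQ n
    have h2 := hD (n + 1)
    have h3 : (0 : ℝ) ≤ n := n.cast_nonneg
    nlinarith
  obtain ⟨Q, hQ⟩ := superquadratic_dominates hA (sub_pos.2 hs)
    (M := C + s * (3 * C)) (by positivity)
  refine dimH_le_of_hausdorffMeasure_ne_top (ne_top_of_le_ne_top
    (ENNReal.ofReal_ne_top (r := Real.exp Q)) ?_)
  let t : ∀ n, (∀ i : Fin n, Fin (M i)) → Set ℝ := fun n p =>
    {x | x ∈ bandSet b C ∧ ∀ i : Fin n, pq x (i + 1) = p i + 1}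
  have hdiam : ∀ n p, Metric.ediam (t n p) ≤ ENNReal.ofReal (R n) := by
    intro n p
    refine Metric.ediam_le fun x hx y hy => ?_
    rw [edist_dist, Real.dist_eq]
    refine ENNReal.ofReal_le_ofReal (abs_sub_le_of_mem_bandSet hC hx.1 hy.1 n fun i hi => ?_)
    exact (hx.2 ⟨i, hi⟩).trans (hy.2 ⟨i, hi⟩).symm
  have hcov : ∀ n, bandSet b C ⊆ ⋃ p, t n p := by
    intro n x hx
    have hlt : ∀ i : Fin n, pq x (i + 1) - 1 < M i := fun i => by
      have h1 := one_le_pq hx.1 hx.2.1 i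
      have h2 : pq x (i + 1) ≤ M i := Nat.le_floor (pq_bounds_of_mem_bandSet hx i).2
      omega
    refine mem_iUnion.2 ⟨fun i => ⟨_, hlt i⟩, hx, fun i => ?_⟩
    have h1 := one_le_pq hx.1 hx.2.1 i
    simp only
    omega
  refine (MeasureTheory.Measure.hausdorffMeasure_le_liminf_sum (s : ℝ) (bandSet b C) _ hRlim t
    (Eventually.of_forall hdiam) (Eventually.of_forall hcov)).trans ?_
  refine liminf_le_of_frequently_le' (hf.mono fun n hn => ?_)
  have hcard : (Fintype.card (∀ i : Fin n, Fin (M i)) : ℝ) ≤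
      Real.exp (A n + C * ((n : ℝ) + 1) ^ 2) := by
    rw [Fintype.card_pi]
    simp only [Fintype.card_fin]
    rw [Fin.prod_univ_eq_prod_range (fun i => M i) n]
    push_cast
    calc ∏ i ∈ Finset.range n, (M i : ℝ)
        ≤ ∏ i ∈ Finset.range n, Real.exp (b i + C * (i + 1)) :=
          Finset.prod_le_prod (fun i _ => Nat.cast_nonneg _)
            fun i _ => Nat.floor_le (Real.exp_pos _).le
      _ = Real.exp (A n + C * ∑ i ∈ Finset.range n, ((i : ℝ) + 1)) := by
          rw [← Real.exp_sum, Finset.sum_add_distrib, ← Finset.mul_sum]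
      _ ≤ _ := by
          have := sum_range_succ_le_sq n
          gcongr
          nlinarith [(n.cast_nonneg : (0 : ℝ) ≤ n)]
  calc ∑ p, Metric.ediam (t n p) ^ (s : ℝ)
      ≤ ∑ _p : (∀ i : Fin n, Fin (M i)), ENNReal.ofReal (R n) ^ (s : ℝ) :=
        Finset.sum_le_sum fun p _ => ENNReal.rpow_le_rpow (hdiam n p) s.2
    _ = ENNReal.ofReal (Fintype.card (∀ i : Fin n, Fin (M i)) * R n ^ (s : ℝ)) := by
        rw [Finset.sum_const, Finset.card_univ, nsmul_eq_mul, ENNReal.ofReal_mul (by positivity),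
          ENNReal.ofReal_natCast, ENNReal.ofReal_rpow_of_nonneg (Real.exp_nonneg _ : 0 ≤ R n) s.coe_nonneg]
    _ ≤ ENNReal.ofReal (Real.exp Q) := by
        refine ENNReal.ofReal_le_ofReal ?_
        calc _ ≤ Real.exp (A n + C * ((n : ℝ) + 1) ^ 2) * R n ^ (s : ℝ) := by gcongr
          _ ≤ Real.exp Q := by
            rw [hR, ← Real.exp_mul, ← Real.exp_add, Real.exp_le_exp]
            have h1 := hQ n
            have h2 := mul_le_mul_of_nonneg_left hn s.2
            simp only [NNReal.val_eq_coe] at h2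
            change (s : ℝ) * (q * A n) ≤ s * A (n + 1) at h2
            nlinarith

/-! ### Mixed radix expansions -/

/-- The remainders of the mixed radix expansion of `y` with bases `t 0, t 1, …`. -/
noncomputable def radixRem (t : ℕ → ℕ) (y : ℝ) : ℕ → ℝ
  | 0 => y
  | n + 1 => Int.fract (t n * radixRem t y n)

/-- The digits of the mixed radix expansion of `y` with bases `t 0, t 1, …`. -/
noncomputable def radixDigit (t : ℕ → ℕ) (y : ℝ) (n : ℕ) : ℕ := ⌊t n * radixRem t y n⌋₊

lemma radixRem_mem (t : ℕ → ℕ) {y : ℝ} (hy : y ∈ Ico (0 : ℝ) 1) (n : ℕ) :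
    radixRem t y n ∈ Ico (0 : ℝ) 1 := by
  cases n with
  | zero => exact hy
  | succ n => exact ⟨Int.fract_nonneg _, Int.fract_lt_one _⟩

lemma radixDigit_add (t : ℕ → ℕ) {y : ℝ} (hy : y ∈ Ico (0 : ℝ) 1) (n : ℕ) :
    t n * radixRem t y n = radixDigit t y n + radixRem t y (n + 1) := by
  have h := (radixRem_mem t hy n).1
  rw [radixDigit, natCast_floor_eq_intCast_floor (by positivity)]
  exact (Int.floor_add_fract _).symm

lemma radixDigit_le (t : ℕ → ℕ) {y : ℝ} (hy : y ∈ Ico (0 : ℝ) 1) (n : ℕ) :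
    radixDigit t y n ≤ t n := by
  have h := radixRem_mem t hy n
  refine Nat.floor_le_of_le (mul_le_of_le_one_right (Nat.cast_nonneg _) h.2.le)

lemma prod_mul_sub_eq (t : ℕ → ℕ) {y z : ℝ} (hy : y ∈ Ico (0 : ℝ) 1) (hz : z ∈ Ico (0 : ℝ) 1)
    (n : ℕ) (h : ∀ i < n, radixDigit t y i = radixDigit t z i) :
    (∏ i ∈ Finset.range n, (t i : ℝ)) * (y - z) = radixRem t y n - radixRem t z n := by
  induction n with
  | zero => simp [radixRem]
  | succ n ih =>
    have h1 := ih fun i hi => h i (by omega)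
    have h2 := radixDigit_add t hy n
    have h3 := radixDigit_add t hz n
    rw [h n (by omega)] at h2
    rw [Finset.prod_range_succ, mul_right_comm, h1, sub_mul, mul_comm, h2, mul_comm _ (t n : ℝ), h3]
    ring

lemma prod_mul_abs_sub_le (t : ℕ → ℕ) {y z : ℝ} (hy : y ∈ Ico (0 : ℝ) 1)
    (hz : z ∈ Ico (0 : ℝ) 1) (n : ℕ) (h : ∀ i < n, radixDigit t y i = radixDigit t z i) :
    (∏ i ∈ Finset.range (n + 1), (t i : ℝ)) * |y - z| ≤
      |(radixDigit t y n : ℝ) - radixDigit t z n| + 1 := by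
  have h1 := prod_mul_sub_eq t hy hz n h
  have h2 := radixDigit_add t hy n
  have h3 := radixDigit_add t hz n
  have h4 := radixRem_mem t hy (n + 1)
  have h5 := radixRem_mem t hz (n + 1)
  rw [← abs_of_nonneg (by positivity : 0 ≤ ∏ i ∈ Finset.range (n + 1), (t i : ℝ)), ← abs_mul,
    Finset.prod_range_succ, mul_right_comm, h1, sub_mul, mul_comm, h2, mul_comm _ (t n : ℝ), h3]
  calc _ = |((radixDigit t y n : ℝ) - radixDigit t z n) +
        (radixRem t y (n + 1) - radixRem t z (n + 1))| := by ring_nf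
    _ ≤ _ := (abs_add_le _ _).trans (by
      gcongr
      rw [abs_le]
      constructor <;> linarith [h4.1, h4.2, h5.1, h5.2])

lemma exists_radixDigit_ne {t : ℕ → ℕ}
    (ht : Tendsto (fun n => ∏ i ∈ Finset.range n, (t i : ℝ)) atTop atTop) {y z : ℝ}
    (hy : y ∈ Ico (0 : ℝ) 1) (hz : z ∈ Ico (0 : ℝ) 1) (hne : y ≠ z) :
    ∃ n, radixDigit t y n ≠ radixDigit t z n := by
  by_contra! hcon
  have hpos : 0 < |y - z| := abs_pos.2 (sub_ne_zero.2 hne)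
  obtain ⟨n, hn⟩ := (((ht.atTop_mul_const hpos).comp (tendsto_add_atTop_nat 1)).eventually_gt_atTop
    1).exists
  have h := prod_mul_abs_sub_le t hy hz n fun i _ => hcon i
  rw [hcon n, sub_self, abs_zero, zero_add] at h
  exact absurd hn (not_lt.2 h)

/-! ### Lower bound -/

/-- A subset of the line which is the image of `[0, 1)` under an expanding map has large
dimension. -/
lemma le_dimH_of_expanding {S : Set ℝ} {g : ℝ → ℝ} (hg : MapsTo g (Ico 0 1) S) {s D : NNReal}
    (hs : 0 < s)
    (h : ∀ y ∈ Ico (0 : ℝ) 1, ∀ z ∈ Ico (0 : ℝ) 1, |y - z| ≤ D * |g y - g z| ^ (s : ℝ)) :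
    s ≤ dimH S := by
  have hinj : InjOn g (Ico 0 1) := by
    intro y hy z hz hyz
    have h1 := h y hy z hz
    rw [hyz, sub_self, abs_zero, Real.zero_rpow (by exact_mod_cast hs.ne'), mul_zero] at h1
    exact sub_eq_zero.1 (abs_nonpos_iff.1 h1)
  have hhold : HolderOnWith D s (Function.invFunOn g (Ico 0 1)) (g '' Ico 0 1) := by
    rintro _ ⟨y, hy, rfl⟩ _ ⟨z, hz, rfl⟩
    rw [hinj.leftInvOn_invFunOn hy, hinj.leftInvOn_invFunOn hz, edist_dist, edist_dist,
      Real.dist_eq, Real.dist_eq, ENNReal.ofReal_rpow_of_nonneg (abs_nonneg _) s.coe_nonneg,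
      ← ENNReal.ofReal_coe_nnreal, ← ENNReal.ofReal_mul D.coe_nonneg]
    exact ENNReal.ofReal_le_ofReal (h y hy z hz)
  have h1 := hhold.dimH_image_le hs
  have h2 : dimH (Ico (0 : ℝ) 1) = 1 := by
    rw [Real.dimH_of_nonempty_interior (by rw [interior_Ico]; exact nonempty_Ioo.2 one_pos)]
    simp
  rw [hinj.invFunOn_image Subset.rfl, h2,
    ENNReal.le_div_iff_mul_le (Or.inl (by exact_mod_cast hs.ne')) (Or.inl ENNReal.coe_ne_top),
    one_mul] at h1
  exact h1.trans (dimH_mono hg.image_subset)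

/-- The number of admissible values of the `i`-th partial quotient. -/
noncomputable def bandWidth (b : ℕ → ℝ) (i : ℕ) : ℕ := ⌊Real.exp (b i) / (i + 1)⌋₊ + 1

/-- The partial quotients coded by the point `y`. -/
noncomputable def codedDigit (b : ℕ → ℝ) (y : ℝ) (i : ℕ) : ℕ :=
  ⌈Real.exp (b i)⌉₊ + 1 + radixDigit (bandWidth b) y i

lemma two_le_codedDigit (b : ℕ → ℝ) (y : ℝ) (i : ℕ) : 2 ≤ codedDigit b y i := by
  have : 0 < ⌈Real.exp (b i)⌉₊ := Nat.ceil_pos.2 (Real.exp_pos _)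
  unfold codedDigit
  omega

lemma bandWidth_bounds (b : ℕ → ℝ) (i : ℕ) :
    Real.exp (b i - (i + 1)) ≤ bandWidth b i ∧
      (bandWidth b i : ℝ) ≤ Real.exp (b i) / (i + 1) + 1 := by
  have h0 : 0 ≤ Real.exp (b i) / ((i : ℝ) + 1) := by positivity
  constructor
  · rw [Real.exp_sub]
    refine (div_le_div_of_nonneg_left (Real.exp_nonneg _) (by positivity : (0 : ℝ) < i + 1) ?_).trans ?_
    · linarith [Real.add_one_le_exp ((i : ℝ) + 1)]
    · rw [bandWidth]
      push_cast
      exact (Nat.lt_floor_add_one _).le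
  · rw [bandWidth]
    push_cast
    linarith [Nat.floor_le h0]

lemma codedDigit_bounds (b : ℕ → ℝ) {y : ℝ} (hy : y ∈ Ico (0 : ℝ) 1) (i : ℕ) :
    Real.exp (b i) ≤ codedDigit b y i ∧
      (codedDigit b y i : ℝ) ≤ Real.exp (b i) + Real.exp (b i) / (i + 1) + 3 := by
  have h1 := (bandWidth_bounds b i).2
  have h2 : (radixDigit (bandWidth b) y i : ℝ) ≤ bandWidth b i := by
    exact_mod_cast radixDigit_le (bandWidth b) hy i
  have h3 := Nat.le_ceil (Real.exp (b i))
  have h4 := Nat.ceil_lt_add_one (Real.exp_nonneg (b i))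
  have h5 : (0 : ℝ) ≤ radixDigit (bandWidth b) y i := Nat.cast_nonneg _
  rw [codedDigit]
  push_cast
  constructor <;> linarith

/-- Uniform exponential control of the coded digits. -/
lemma exists_codedDigit_le {b : ℕ → ℝ} (hb : ∀ K, ∃ D, ∀ n : ℕ, K * n - D ≤ b n) :
    ∃ C : ℝ, 0 ≤ C ∧ ∀ y ∈ Ico (0 : ℝ) 1, ∀ i : ℕ,
      (codedDigit b y i : ℝ) + 1 ≤ Real.exp (b i + C * (i + 1)) := by
  obtain ⟨D, hD⟩ := hb 0
  refine ⟨2 + 4 * Real.exp D, by positivity, fun y hy i => ?_⟩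
  have h1 := (codedDigit_bounds b hy i).2
  have h2 : Real.exp (b i) / ((i : ℝ) + 1) ≤ Real.exp (b i) :=
    div_le_self (Real.exp_nonneg _) (by linarith [(i.cast_nonneg : (0 : ℝ) ≤ i)])
  have h3 : 1 ≤ Real.exp D * Real.exp (b i) := by
    rw [← Real.exp_add]
    exact Real.one_le_exp (by linarith [hD i])
  have h4 : 2 + 4 * Real.exp D ≤ Real.exp ((2 + 4 * Real.exp D) * (i + 1)) := by
    refine le_trans ?_ (Real.add_one_le_exp _)
    have : 0 ≤ (2 + 4 * Real.exp D) * (i : ℝ) := by positivity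
    linarith
  rw [Real.exp_add]
  have h5 := mul_le_mul_of_nonneg_left h4 (Real.exp_nonneg (b i))
  linarith

lemma tendsto_codedDigit_div {b : ℕ → ℝ} (hb : ∀ K, ∃ D, ∀ n : ℕ, K * n - D ≤ b n) {y : ℝ}
    (hy : y ∈ Ico (0 : ℝ) 1) :
    Tendsto (fun i => (codedDigit b y i : ℝ) / Real.exp (b i)) atTop (nhds 1) := by
  have hbt : Tendsto b atTop atTop := by
    obtain ⟨D, hD⟩ := hb 1
    refine tendsto_atTop_mono hD ?_
    simp only [one_mul, sub_eq_add_neg]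
    exact tendsto_atTop_add_const_right _ _ tendsto_natCast_atTop_atTop
  have h1 : Tendsto (fun i : ℕ => 1 + 1 / ((i : ℝ) + 1) + 3 * Real.exp (-b i)) atTop (nhds 1) := by
    have := (tendsto_one_div_add_atTop_nhds_zero_nat (𝕜 := ℝ)).const_add 1 |>.add
      ((Real.tendsto_exp_neg_atTop_nhds_zero.comp hbt).const_mul 3)
    simpa using this
  refine tendsto_of_tendsto_of_tendsto_of_le_of_le tendsto_const_nhds h1 (fun i => ?_) fun i => ?_
  · exact (one_le_div (Real.exp_pos _)).2 (codedDigit_bounds b hy i).1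
  · refine (div_le_iff₀ (Real.exp_pos _)).2 ((codedDigit_bounds b hy i).2.trans (le_of_eq ?_))
    rw [Real.exp_neg]
    field_simp

/-- Points whose partial quotients are at least `2` and first differ at place `n`. -/
lemma le_abs_sub {x y : ℝ} (hx : x ∈ Ioo (0 : ℝ) 1) (hxi : Irrational x)
    (hy : y ∈ Ioo (0 : ℝ) 1) (hyi : Irrational y) (hx2 : ∀ i, 2 ≤ pq x (i + 1))
    (hy2 : ∀ i, 2 ≤ pq y (i + 1)) (n : ℕ) (h : ∀ i < n, pq x (i + 1) = pq y (i + 1))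
    (hn : pq x (n + 1) ≠ pq y (n + 1)) :
    (∏ i ∈ Finset.range (n + 1), gaussMap^[i] x * gaussMap^[i] y) *
      (|(pq x (n + 1) : ℝ) - pq y (n + 1)| / 2) ≤ |x - y| := by
  rw [abs_sub_eq_prod hx hxi hy hyi n h, abs_orbit_sub hx hxi hy hyi n, ← mul_assoc,
    ← Finset.prod_range_succ (fun i => gaussMap^[i] x * gaussMap^[i] y)]
  refine mul_le_mul_of_nonneg_left ?_ (Finset.prod_nonneg fun i _ =>
    (mul_pos (orbit_mem hx hxi i).1.1 (orbit_mem hy hyi i).1.1).le)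
  have half : ∀ z : ℝ, z ∈ Ioo (0 : ℝ) 1 → Irrational z → (∀ i, 2 ≤ pq z (i + 1)) →
      0 < gaussMap^[n + 1] z ∧ gaussMap^[n + 1] z ≤ 1 / 2 := fun z hz hzi hz2 =>
    ⟨(orbit_mem hz hzi _).1.1, (orbit_le hz hzi _).trans
      (one_div_le_one_div_of_le two_pos (by exact_mod_cast hz2 _))⟩
  have h1 := half x hx hxi hx2
  have h2 := half y hy hyi hy2
  have h3 : |gaussMap^[n + 1] x - gaussMap^[n + 1] y| ≤ 1 / 2 := by
    rw [abs_le]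
    constructor <;> linarith
  have h4 : (1 : ℝ) ≤ |(pq x (n + 1) : ℝ) - pq y (n + 1)| := by
    have h5 : (1 : ℤ) ≤ |(pq x (n + 1) : ℤ) - pq y (n + 1)| :=
      Int.one_le_abs (sub_ne_zero.2 (by exact_mod_cast hn))
    exact_mod_cast h5
  have h6 := abs_sub_abs_le_abs_sub ((pq x (n + 1) : ℝ) - pq y (n + 1))
    (-(gaussMap^[n + 1] x - gaussMap^[n + 1] y))
  rw [abs_neg, sub_neg_eq_add] at h6
  linarith

lemma exp_le_prod_bandWidth (b : ℕ → ℝ) (n : ℕ) :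
    Real.exp (∑ i ∈ Finset.range n, b i - (n : ℝ) ^ 2) ≤
      ∏ i ∈ Finset.range n, (bandWidth b i : ℝ) := by
  calc _ ≤ Real.exp (∑ i ∈ Finset.range n, (b i - (i + 1))) := by
        rw [Real.exp_le_exp, Finset.sum_sub_distrib]
        linarith [sum_range_succ_le_sq n]
    _ ≤ _ := by
        rw [Real.exp_sum]
        exact Finset.prod_le_prod (fun i _ => Real.exp_nonneg _) fun i _ => (bandWidth_bounds b i).1

lemma exp_le_prod_orbit {b : ℕ → ℝ} {C x y : ℝ} (hC : 0 ≤ C) (hx : x ∈ Ioo (0 : ℝ) 1)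
    (hxi : Irrational x) (hy : y ∈ Ioo (0 : ℝ) 1) (hyi : Irrational y)
    (hxb : ∀ i : ℕ, (pq x (i + 1) : ℝ) + 1 ≤ Real.exp (b i + C * (i + 1)))
    (hyb : ∀ i : ℕ, (pq y (i + 1) : ℝ) + 1 ≤ Real.exp (b i + C * (i + 1))) (n : ℕ) :
    Real.exp (-2 * ∑ i ∈ Finset.range n, b i - 2 * C * (n : ℝ) ^ 2) ≤
      ∏ i ∈ Finset.range n, gaussMap^[i] x * gaussMap^[i] y := by
  have low : ∀ z : ℝ, z ∈ Ioo (0 : ℝ) 1 → Irrational z →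
      (∀ i : ℕ, (pq z (i + 1) : ℝ) + 1 ≤ Real.exp (b i + C * (i + 1))) →
      ∀ i : ℕ, Real.exp (-(b i + C * (i + 1))) ≤ gaussMap^[i] z := by
    intro z hz hzi hzb i
    refine le_trans ?_ (le_orbit hz hzi i)
    rw [Real.exp_neg, one_div]
    exact inv_anti₀ (by positivity) (hzb i)
  calc _ ≤ Real.exp (∑ i ∈ Finset.range n, -2 * (b i + C * (i + 1))) := by
        rw [Real.exp_le_exp, ← Finset.mul_sum, Finset.sum_add_distrib, ← Finset.mul_sum]
        have := mul_le_mul_of_nonneg_left (sum_range_succ_le_sq n) hC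
        linarith
    _ ≤ _ := by
        rw [Real.exp_sum]
        refine Finset.prod_le_prod (fun i _ => Real.exp_nonneg _) fun i _ => ?_
        rw [show -2 * (b i + C * ((i : ℝ) + 1)) = -(b i + C * (i + 1)) + -(b i + C * (i + 1)) by ring,
          Real.exp_add]
        exact mul_le_mul (low x hx hxi hxb i) (low y hy hyi hyb i) (Real.exp_nonneg _)
          (orbit_mem hx hxi i).1.1.le

lemma le_dimH_of_codedDigit {b : ℕ → ℝ} (hb : ∀ K, ∃ D, ∀ n : ℕ, K * n - D ≤ b n) {s : NNReal}
    (hs0 : 0 < s) {r : ℝ} (hr : 0 ≤ r) (hs : s * (1 + r) < 1)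
    (hf : ∀ᶠ n in atTop, ∑ i ∈ Finset.range (n + 1), b i ≤ r * ∑ i ∈ Finset.range n, b i)
    {S : Set ℝ} (hS : ∀ y ∈ Ico (0 : ℝ) 1, cfLim (codedDigit b y) ∈ S) : s ≤ dimH S := by
  have hA := sum_superquadratic hb
  set A : ℕ → ℝ := fun n => ∑ i ∈ Finset.range n, b i with hAdef
  have hAs : ∀ n, A (n + 1) = A n + b n := fun n => Finset.sum_range_succ _ _
  have hs0' : (0 : ℝ) < s := hs0
  have hs1 : (s : ℝ) < 1 := by nlinarith
  obtain ⟨C, hC, hCb⟩ := exists_codedDigit_le hb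
  obtain ⟨Q₁, hQ₁⟩ := superquadratic_dominates hA (sub_pos.2 hs)
    (M := C + 1 + 2 * s * C) (by positivity)
  obtain ⟨Q, hQ⟩ : ∃ Q, ∀ n : ℕ,
      s * (A n + A (n + 1)) - A n + (C + 1 + 2 * s * C) * ((n : ℝ) + 1) ^ 2 ≤ Q := by
    refine exists_bound_of_eventually (Q := Q₁) (hf.mono fun n hn => ?_)
    have h1 := hQ₁ n
    have h2 := mul_le_mul_of_nonneg_left hn hs0'.le
    change (s : ℝ) * A (n + 1) ≤ s * (r * A n) at h2
    linarith
  have ht : Tendsto (fun n => ∏ i ∈ Finset.range n, (bandWidth b i : ℝ)) atTop atTop := by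
    refine tendsto_atTop_mono (exp_le_prod_bandWidth b) (Real.tendsto_exp_atTop.comp ?_)
    obtain ⟨D, hD⟩ := hA 2
    refine tendsto_atTop_mono (f := fun n : ℕ => (n : ℝ) - D) (fun n => ?_) ?_
    · have h1 := hD n
      have h2 : (n : ℝ) ≤ (n : ℝ) ^ 2 := by exact_mod_cast Nat.le_self_pow two_ne_zero n
      linarith
    · simp only [sub_eq_add_neg]
      exact tendsto_atTop_add_const_right _ _ tendsto_natCast_atTop_atTop
  refine le_dimH_of_expanding (g := fun y => cfLim (codedDigit b y)) hS
    (D := (Real.exp (1 + s + Q)).toNNReal) hs0 fun y hy z hz => ?_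
  rw [Real.coe_toNNReal _ (Real.exp_nonneg _)]
  rcases eq_or_ne y z with rfl | hne
  · simp only [sub_self, abs_zero]
    positivity
  have hex := exists_radixDigit_ne ht hy hz hne
  obtain ⟨n, hn, hlt⟩ : ∃ n, radixDigit (bandWidth b) y n ≠ radixDigit (bandWidth b) z n ∧
      ∀ i < n, radixDigit (bandWidth b) y i = radixDigit (bandWidth b) z i := by
    classical
    exact ⟨Nat.find hex, Nat.find_spec hex, fun i hi => not_not.1 (Nat.find_min hex hi)⟩
  have unit : ∀ w, cfLim (codedDigit b w) ∈ Ioo (0 : ℝ) 1 := fun w => by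
    have := cfLim_mem _ (two_le_codedDigit b w)
    constructor <;> linarith
  have irr := fun w => irrational_cfLim _ (two_le_codedDigit b w)
  have hpq := fun w => pq_cfLim _ (two_le_codedDigit b w)
  have h2 : ∀ w i, 2 ≤ pq (cfLim (codedDigit b w)) (i + 1) := fun w i => by
    rw [hpq]
    exact two_le_codedDigit b w i
  have hbd : ∀ w ∈ Ico (0 : ℝ) 1, ∀ i : ℕ, (pq (cfLim (codedDigit b w)) (i + 1) : ℝ) + 1 ≤
      Real.exp (b i + C * (i + 1)) := fun w hw i => by
    rw [hpq]
    exact hCb w hw i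
  have hdist := le_abs_sub (unit y) (irr y) (unit z) (irr z) (h2 y) (h2 z) n
    (fun i hi => by rw [hpq, hpq, codedDigit, codedDigit, hlt i hi])
    (by rw [hpq, hpq, codedDigit, codedDigit]; omega)
  have hprod := exp_le_prod_orbit hC (unit y) (irr y) (unit z) (irr z) (hbd y hy) (hbd z hz) (n + 1)
  have hrad := prod_mul_abs_sub_le (bandWidth b) hy hz n hlt
  have hT := exp_le_prod_bandWidth b (n + 1)
  have hκe : |(pq (cfLim (codedDigit b y)) (n + 1) : ℝ) - pq (cfLim (codedDigit b z)) (n + 1)| =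
      |(radixDigit (bandWidth b) y n : ℝ) - radixDigit (bandWidth b) z n| := by
    rw [hpq, hpq, codedDigit, codedDigit]
    push_cast
    ring_nf
  rw [hκe] at hdist
  have hκ1 : (1 : ℝ) ≤ |(radixDigit (bandWidth b) y n : ℝ) - radixDigit (bandWidth b) z n| := by
    have h5 : (1 : ℤ) ≤ |(radixDigit (bandWidth b) y n : ℤ) - radixDigit (bandWidth b) z n| :=
      Int.one_le_abs (sub_ne_zero.2 (by exact_mod_cast hn))
    exact_mod_cast h5
  have hκ2 : |(radixDigit (bandWidth b) y n : ℝ) - radixDigit (bandWidth b) z n| ≤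
      Real.exp (b n + C * (n + 1)) := by
    have small : ∀ w ∈ Ico (0 : ℝ) 1, (0 : ℝ) ≤ radixDigit (bandWidth b) w n ∧
        (radixDigit (bandWidth b) w n : ℝ) ≤ Real.exp (b n + C * (n + 1)) := fun w hw => by
      refine ⟨Nat.cast_nonneg _, le_trans ?_ (hCb w hw n)⟩
      have : radixDigit (bandWidth b) w n ≤ codedDigit b w n + 1 := by
        unfold codedDigit
        omega
      exact_mod_cast this
    rw [abs_le]
    constructor <;> linarith [small y hy, small z hz]
  generalize |(radixDigit (bandWidth b) y n : ℝ) - radixDigit (bandWidth b) z n| = κ at *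
  obtain ⟨L, rfl⟩ : ∃ L, κ = Real.exp L := ⟨Real.log κ, (Real.exp_log (by linarith)).symm⟩
  rw [Real.exp_le_exp] at hκ2
  have two_le : (2 : ℝ) ≤ Real.exp 1 := by linarith [Real.add_one_le_exp (1 : ℝ)]
  have hyz : |y - z| ≤ Real.exp (1 + L - A (n + 1) + ((n : ℝ) + 1) ^ 2) := by
    have h6 : Real.exp (A (n + 1) - ((n : ℝ) + 1) ^ 2) * |y - z| ≤ Real.exp (1 + L) := by
      have := mul_le_mul_of_nonneg_right hT (abs_nonneg (y - z))
      push_cast at this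
      refine this.trans (hrad.trans ?_)
      rw [Real.exp_add]
      nlinarith
    rw [show 1 + L - A (n + 1) + ((n : ℝ) + 1) ^ 2 = 1 + L - (A (n + 1) - ((n : ℝ) + 1) ^ 2) by ring,
      Real.exp_sub, le_div_iff₀' (Real.exp_pos _)]
    exact h6
  have hxx : Real.exp (L - 1 - 2 * A (n + 1) - 2 * C * ((n : ℝ) + 1) ^ 2) ≤
      |cfLim (codedDigit b y) - cfLim (codedDigit b z)| := by
    refine le_trans ?_ hdist
    push_cast at hprod
    rw [show L - 1 - 2 * A (n + 1) - 2 * C * ((n : ℝ) + 1) ^ 2 =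
      (-2 * A (n + 1) - 2 * C * ((n : ℝ) + 1) ^ 2) + (L - 1) by ring, Real.exp_add]
    refine mul_le_mul hprod ?_ (Real.exp_nonneg _) ((Real.exp_nonneg _).trans hprod)
    rw [Real.exp_sub]
    gcongr
  have hpow := Real.rpow_le_rpow (Real.exp_nonneg _) hxx hs0'.le
  rw [← Real.exp_mul] at hpow
  refine hyz.trans (le_trans ?_ (mul_le_mul_of_nonneg_left hpow (Real.exp_nonneg (1 + s + Q))))
  rw [← Real.exp_add, Real.exp_le_exp]
  have h7 := hQ n
  have h8 := mul_le_mul_of_nonneg_left hκ2 (sub_nonneg.2 hs1.le)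
  have h9 := hAs n
  have h10 : (1 - s) * (C * ((n : ℝ) + 1)) ≤ C * ((n : ℝ) + 1) ^ 2 := by
    have h11 : 0 ≤ C * ((n : ℝ) + 1) := by positivity
    have h12 : 0 ≤ C * ((n : ℝ) + 1) * n := by positivity
    nlinarith
  have h13 : b n = A (n + 1) - A n := by linarith
  rw [h13] at h8
  nlinarith

/-! ### The level set -/

lemma Lmax_succ (x : ℝ) (n : ℕ) :
    Lmax x (n + 1) = max (Lmax x n) (pq x (n + 1) * pq x (n + 2)) := by
  have h : Finset.Icc 1 (n + 1) = insert (n + 1) (Finset.Icc 1 n) := by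
    ext k
    simp only [Finset.mem_Icc, Finset.mem_insert]
    omega
  rw [Lmax, h, Finset.sup_insert, sup_comm]
  rfl

/-- A sequence asymptotic to a superexponentially growing one is eventually increasing. -/
lemma eventually_lt_succ {φ : ℕ → ℝ} (hpos : ∀ n, 0 < n → 0 < φ n)
    (hφ : Tendsto (fun n => Real.log (φ (n + 1)) - Real.log (φ n)) atTop atTop) {u : ℕ → ℕ}
    (hu : Tendsto (fun n => (u n : ℝ) / φ n) atTop (nhds 1)) : ∀ᶠ n in atTop, u n < u (n + 1) := by
  filter_upwards [hu.eventually_lt_const (show (1 : ℝ) < 2 by norm_num),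
    ((tendsto_add_atTop_iff_nat 1).2 hu).eventually_const_lt (show (1 / 2 : ℝ) < 1 by norm_num),
    hφ.eventually_ge_atTop (Real.log 4), eventually_gt_atTop 0] with n h1 h2 h3 hn
  have p1 := hpos n hn
  have p2 := hpos (n + 1) n.succ_pos
  rw [div_lt_iff₀ p1] at h1
  rw [lt_div_iff₀ p2] at h2
  have h4 : 4 * φ n ≤ φ (n + 1) := by
    rw [← Real.log_le_log_iff (by positivity) p2, Real.log_mul (by norm_num) p1.ne']
    linarith
  have : (u n : ℝ) < u (n + 1) := by linarith
  exact_mod_cast this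

lemma abs_le_mul_of_abs_add_le {e : ℕ → ℝ} {Q : ℝ} (h : ∀ n, |e n + e (n + 1)| ≤ Q) (n : ℕ) :
    |e n| ≤ max Q |e 0| * (n + 1) := by
  induction n with
  | zero => simp
  | succ n ih =>
    have h1 : |e (n + 1)| ≤ |e n + e (n + 1)| + |e n| := by
      have := abs_sub (e n + e (n + 1)) (e n)
      rwa [add_sub_cancel_left] at this
    push_cast
    linarith [h n, le_max_left Q |e 0|]

lemma exists_mem_bandSet {φ : ℕ → ℝ} (hpos : ∀ n, 0 < n → 0 < φ n)
    (hφ : Tendsto (fun n => Real.log (φ (n + 1)) - Real.log (φ n)) atTop atTop) {x : ℝ}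
    (hx : x ∈ Lset φ) : ∃ C : ℕ, x ∈ bandSet (altSum fun n => Real.log (φ n)) C := by
  obtain ⟨h01, hirr, hlim⟩ := hx
  set b := altSum fun n => Real.log (φ n) with hb
  set e : ℕ → ℝ := fun i => Real.log (pq x (i + 1)) - b i with he
  have hev : ∀ᶠ n in atTop, |e n + e (n + 1)| ≤ Real.log 2 := by
    have hlim1 := (tendsto_add_atTop_iff_nat 1).2 hlim
    filter_upwards [eventually_lt_succ hpos hφ hlim,
      hlim1.eventually_lt_const (show (1 : ℝ) < 2 by norm_num),
      hlim1.eventually_const_lt (show (1 / 2 : ℝ) < 1 by norm_num)] with n h1 h2 h3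
    have p := hpos (n + 1) n.succ_pos
    have c1 : (0 : ℝ) < pq x (n + 1) := by exact_mod_cast one_le_pq h01 hirr n
    have c2 : (0 : ℝ) < pq x (n + 1 + 1) := by exact_mod_cast one_le_pq h01 hirr (n + 1)
    have h4 : (Lmax x (n + 1) : ℝ) = pq x (n + 1) * pq x (n + 1 + 1) := by
      rw [Lmax_succ] at h1 ⊢
      rw [max_eq_right (by by_contra hc; rw [max_eq_left (by omega)] at h1; exact h1.false)]
      push_cast
      rfl
    have h5 : e n + e (n + 1) = Real.log (Lmax x (n + 1) / φ (n + 1)) := by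
      rw [h4, Real.log_div (by positivity) p.ne', Real.log_mul c1.ne' c2.ne']
      simp only [he, hb, altSum]
      ring
    rw [h5, abs_le]
    constructor
    · rw [← Real.log_inv]
      exact Real.log_le_log (by norm_num) (by linarith)
    · exact Real.log_le_log (by linarith) h2.le
  obtain ⟨Q, hQ⟩ := exists_bound_of_eventually hev
  obtain ⟨C, hC⟩ := exists_nat_ge (max Q |e 0|)
  refine ⟨C, h01, hirr, fun i => (abs_le_mul_of_abs_add_le hQ i).trans ?_⟩
  gcongr

lemma eventually_Lmax_eq {x : ℝ}
    (h : ∀ᶠ n in atTop, pq x n * pq x (n + 1) < pq x (n + 1) * pq x (n + 2)) :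
    ∀ᶠ n in atTop, Lmax x n = pq x n * pq x (n + 1) := by
  obtain ⟨N, hN⟩ := eventually_atTop.1 h
  have grow : ∀ k, k ≤ pq x (N + k) * pq x (N + k + 1) := by
    intro k
    induction k with
    | zero => exact Nat.zero_le _
    | succ k ih => exact Nat.succ_le_of_lt (ih.trans_lt (hN (N + k) (by omega)))
  have hle : ∀ n, N ≤ n → Lmax x n ≤ max (Lmax x N) (pq x n * pq x (n + 1)) := by
    intro n hn
    induction n, hn using Nat.le_induction with
    | base => exact le_max_left _ _
    | succ n hn ih =>
      rw [Lmax_succ]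
      have := hN n hn
      exact max_le (ih.trans (max_le_max le_rfl this.le)) (le_max_right _ _)
  refine eventually_atTop.2 ⟨N + Lmax x N + 1, fun n hn => le_antisymm ?_ ?_⟩
  · have h1 := grow (n - N)
    rw [Nat.add_sub_cancel' (by omega)] at h1
    exact (hle n (by omega)).trans (max_le (by omega) le_rfl)
  · obtain ⟨m, rfl⟩ := Nat.exists_eq_succ_of_ne_zero (show n ≠ 0 by omega)
    rw [Nat.succ_eq_add_one, Lmax_succ]
    exact le_max_right _ _

lemma exp_altSum_mul {φ : ℕ → ℝ} (hpos : ∀ n, 0 < n → 0 < φ n) (n : ℕ) :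
    Real.exp (altSum (fun n => Real.log (φ n)) n) *
      Real.exp (altSum (fun n => Real.log (φ n)) (n + 1)) = φ (n + 1) := by
  rw [← Real.exp_add, altSum.eq_2, add_sub_cancel, Real.exp_log (hpos _ n.succ_pos)]

lemma cfLim_codedDigit_mem_Lset {φ : ℕ → ℝ} (hpos : ∀ n, 0 < n → 0 < φ n)
    (hφ : Tendsto (fun n => Real.log (φ (n + 1)) - Real.log (φ n)) atTop atTop) {y : ℝ}
    (hy : y ∈ Ico (0 : ℝ) 1) :
    cfLim (codedDigit (altSum fun n => Real.log (φ n)) y) ∈ Lset φ := by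
  set b := altSum fun n => Real.log (φ n) with hb
  have h2 := two_le_codedDigit b y
  have hmem := cfLim_mem _ h2
  have hlim : Tendsto (fun n => ((pq (cfLim (codedDigit b y)) n *
      pq (cfLim (codedDigit b y)) (n + 1) : ℕ) : ℝ) / φ n) atTop (nhds 1) := by
    refine (tendsto_add_atTop_iff_nat 1).1 ?_
    have h3 := tendsto_codedDigit_div (altSum_superlinear (ψ := fun n => Real.log (φ n)) hφ) hy
    have h4 := h3.mul ((tendsto_add_atTop_iff_nat 1).2 h3)
    rw [mul_one] at h4
    refine h4.congr fun n => ?_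
    rw [pq_cfLim _ h2, pq_cfLim _ h2, ← exp_altSum_mul hpos n]
    push_cast
    exact div_mul_div_comm _ _ _ _
  refine ⟨⟨hmem.1, by linarith⟩, irrational_cfLim _ h2, ?_⟩
  refine hlim.congr' ?_
  filter_upwards [eventually_Lmax_eq (eventually_lt_succ hpos hφ hlim)] with n hn
  rw [hn]

/-! ### Regularly increasing functions of index larger than one -/

lemma tendsto_sub_of_mul_le {f f' : ℝ → ℝ} {r X : ℝ} (hr : 1 < r) (hX : 0 < X)
    (hpos : ∀ x ∈ Ici X, 0 < f x) (hd : ∀ x ∈ Ici X, HasDerivAt f (f' x) x)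
    (h : ∀ x ∈ Ici X, r * f x ≤ x * f' x) :
    Tendsto (fun n : ℕ => f ((n + 1 : ℕ) : ℝ) - f n) atTop atTop := by
  have hder : ∀ x ∈ Ici X, HasDerivAt (fun x => f x * x ^ (-r))
      (f' x * x ^ (-r) + f x * (-r * x ^ (-r - 1))) x := fun x hx =>
    (hd x hx).mul (Real.hasDerivAt_rpow_const (Or.inl (hX.trans_le hx).ne'))
  have hmono : MonotoneOn (fun x => f x * x ^ (-r)) (Ici X) := by
    refine monotoneOn_of_deriv_nonneg (convex_Ici X)
      (fun x hx => (hder x hx).continuousAt.continuousWithinAt)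
      (fun x hx => (hder x (interior_subset hx)).differentiableAt.differentiableWithinAt)
      fun x hx => ?_
    have hx' := interior_subset hx
    have hx0 : 0 < x := hX.trans_le hx'
    rw [(hder x hx').deriv]
    have e : x ^ (-r) = x ^ (-r - 1) * x := by
      rw [← Real.rpow_add_one hx0.ne']
      ring_nf
    rw [e, show f' x * (x ^ (-r - 1) * x) + f x * (-r * x ^ (-r - 1)) =
      x ^ (-r - 1) * (x * f' x - r * f x) by ring]
    exact mul_nonneg (Real.rpow_nonneg hx0.le _) (sub_nonneg.2 (h x hx'))
  set c := f X * X ^ (-r) with hc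
  have hcpos : 0 < c := mul_pos (hpos X self_mem_Ici) (Real.rpow_pos_of_pos hX _)
  have hlow : ∀ x ∈ Ici X, c * x ^ (r - 1) ≤ f' x := by
    intro x hx
    have hx0 : 0 < x := hX.trans_le hx
    have h1 : c ≤ f x * x ^ (-r) := hmono self_mem_Ici hx hx
    have h2 : c * x ^ r ≤ f x := by
      rw [Real.rpow_neg hx0.le, ← div_eq_mul_inv, le_div_iff₀ (Real.rpow_pos_of_pos hx0 _)] at h1
      exact h1
    rw [Real.rpow_sub_one hx0.ne', ← mul_div_assoc, div_le_iff₀ hx0]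
    nlinarith [h x hx, hpos x hx]
  have ht : Tendsto (fun n : ℕ => c * (n : ℝ) ^ (r - 1)) atTop atTop :=
    ((tendsto_rpow_atTop (sub_pos.2 hr)).comp tendsto_natCast_atTop_atTop).const_mul_atTop hcpos
  refine tendsto_atTop_mono' _ ?_ ht
  filter_upwards [tendsto_natCast_atTop_atTop.eventually_ge_atTop X] with n hn
  have hin : ∀ x, (n : ℝ) ≤ x → x ∈ Ici X := fun x hx => hn.trans hx
  obtain ⟨ξ, hξ, he⟩ := exists_hasDerivAt_eq_slope f f' (a := n) (b := ((n + 1 : ℕ) : ℝ))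
    (by push_cast; linarith)
    (fun x hx => (hd x (hin x hx.1)).continuousAt.continuousWithinAt)
    fun x hx => hd x (hin x hx.1.le)
  have e : f ((n + 1 : ℕ) : ℝ) - f n = f' ξ := by
    rw [he]
    push_cast
    rw [add_sub_cancel_left, div_one]
  rw [e]
  refine le_trans ?_ (hlow ξ (hin ξ hξ.1.le))
  exact mul_le_mul_of_nonneg_left
    (Real.rpow_le_rpow n.cast_nonneg hξ.1.le (by linarith)) hcpos.le

lemma tendsto_sub_of_regularly_increasing {f : ℝ → ℝ}
    (h : (∃ ρ : ℝ, 1 < ρ ∧ RegInc f ρ) ∨ RegIncTop f) :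
    Tendsto (fun n : ℕ => f ((n + 1 : ℕ) : ℝ) - f n) atTop atTop := by
  obtain ⟨c, hc, f', hpos, hd, r, hr, hev⟩ : ∃ c > (0 : ℝ), ∃ f' : ℝ → ℝ,
      (∀ x ∈ Ici c, 0 < f x) ∧ (∀ x ∈ Ici c, HasDerivAt f (f' x) x) ∧
      ∃ r : ℝ, 1 < r ∧ ∀ᶠ x in atTop, r ≤ x * f' x / f x := by
    rcases h with ⟨ρ, hρ, c, hc, f', hpos, hd, -, -, -, hlim⟩ | ⟨c, hc, f', hpos, hd, -, -, -, hlim⟩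
    · obtain ⟨r, hr1, hr2⟩ := exists_between hρ
      exact ⟨c, hc, f', hpos, hd, r, hr1, hlim.eventually_const_le hr2⟩
    · exact ⟨c, hc, f', hpos, hd, 2, one_lt_two, hlim.eventually_ge_atTop 2⟩
  obtain ⟨Y, hY⟩ := eventually_atTop.1 hev
  have hsub : ∀ x ∈ Ici (max c Y), x ∈ Ici c := fun x hx => (le_max_left c Y).trans hx
  refine tendsto_sub_of_mul_le hr (lt_max_of_lt_left hc) (fun x hx => hpos x (hsub x hx))
    (fun x hx => hd x (hsub x hx)) fun x hx => ?_
  exact (le_div_iff₀ (hpos x (hsub x hx))).1 (hY x ((le_max_right c Y).trans hx))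

/-! ### The dimension formula -/

/-- The upper limit of the ratios of consecutive partial sums of `b`. -/
noncomputable def partialSumRatio (b : ℕ → ℝ) : ℝ≥0∞ :=
  limsup (fun n : ℕ => ENNReal.ofReal
    ((∑ i ∈ Finset.range (n + 1), b i) / ∑ i ∈ Finset.range n, b i)) atTop

lemma betaVal_eq_partialSumRatio (φ : ℝ → ℝ) :
    betaVal φ = partialSumRatio (altSum fun n => Real.log (φ n)) := by
  rw [partialSumRatio, ← limsup_nat_add _ 2, betaVal, ← limsup_nat_add _ 1]
  congr 1
  ext n
  rw [sum_altSum, sum_altSum, Nat.add_sub_cancel]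

lemma eventually_sum_pos {b : ℕ → ℝ} (hb : ∀ K, ∃ D, ∀ n : ℕ, K * n - D ≤ b n) :
    ∀ᶠ n in atTop, 0 < ∑ i ∈ Finset.range n, b i := by
  obtain ⟨D, hD⟩ := sum_superquadratic hb 1
  filter_upwards [(tendsto_natCast_atTop_atTop (R := ℝ)).eventually_gt_atTop (max D 1)] with n hn
  have h1 := (le_max_left D 1).trans_lt hn
  have h2 := (le_max_right D 1).trans_lt hn
  nlinarith [hD n]

lemma exists_frequently_mul_sum_le {b : ℕ → ℝ} (hb : ∀ K, ∃ D, ∀ n : ℕ, K * n - D ≤ b n)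
    {s : NNReal} (hs : 1 / (1 + partialSumRatio b) < s) :
    ∃ q : ℝ, 1 < s * (1 + q) ∧
      ∃ᶠ n in atTop, q * ∑ i ∈ Finset.range n, b i ≤ ∑ i ∈ Finset.range (n + 1), b i := by
  have hpos := eventually_sum_pos hb
  rcases lt_or_ge 1 s with h1 | h1
  · refine ⟨0, by simpa using h1, Eventually.frequently ?_⟩
    filter_upwards [(tendsto_add_atTop_nat 1).eventually hpos] with n hn
    rw [zero_mul]
    exact hn.le
  have hs0 : s ≠ 0 := fun h => not_lt_zero (hs.trans_eq (by simp [h]))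
  have hinv : (s : ℝ≥0∞)⁻¹ < partialSumRatio b + 1 := by
    rw [ENNReal.inv_lt_iff_inv_lt, add_comm, ← one_div]
    exact hs
  have hsub : (s : ℝ≥0∞)⁻¹ - 1 < partialSumRatio b :=
    ENNReal.sub_lt_of_lt_add (ENNReal.one_le_inv.2 (by exact_mod_cast h1)) hinv
  obtain ⟨q, hq1, hq2⟩ := ENNReal.lt_iff_exists_nnreal_btwn.1 hsub
  refine ⟨q, ?_, ?_⟩
  · have h2 : (s : ℝ≥0∞)⁻¹ < 1 + q :=
      ENNReal.lt_add_of_sub_lt_left (Or.inr ENNReal.one_ne_top) hq1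
    rw [← ENNReal.coe_inv hs0] at h2
    have h3 : s⁻¹ < 1 + q := by exact_mod_cast h2
    rw [inv_lt_iff_one_lt_mul₀ (pos_iff_ne_zero.2 hs0), mul_comm] at h3
    exact_mod_cast h3
  · refine ((frequently_lt_of_lt_limsup (by isBoundedDefault) hq2).and_eventually hpos).mono
      fun n hn => ?_
    obtain ⟨h2, h3⟩ := hn
    rw [← ENNReal.ofReal_coe_nnreal, ENNReal.ofReal_lt_ofReal_iff'] at h2
    exact (le_div_iff₀ h3).1 h2.1.le

lemma exists_eventually_sum_le_mul {b : ℕ → ℝ} (hb : ∀ K, ∃ D, ∀ n : ℕ, K * n - D ≤ b n)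
    {s : NNReal} (hs0 : 0 < s) (hs : s < 1 / (1 + partialSumRatio b)) :
    ∃ r : ℝ, 0 ≤ r ∧ s * (1 + r) < 1 ∧
      ∀ᶠ n in atTop, ∑ i ∈ Finset.range (n + 1), b i ≤ r * ∑ i ∈ Finset.range n, b i := by
  have hinv : 1 + partialSumRatio b < (s : ℝ≥0∞)⁻¹ := by
    rw [← ENNReal.inv_lt_inv, inv_inv, ← one_div]
    exact hs
  obtain ⟨r, hr1, hr2⟩ := ENNReal.lt_iff_exists_nnreal_btwn.1 (lt_tsub_iff_left.2 hinv)
  refine ⟨r, r.coe_nonneg, ?_, ?_⟩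
  · have h2 : 1 + (r : ℝ≥0∞) < (s : ℝ≥0∞)⁻¹ := lt_tsub_iff_left.1 hr2
    rw [← ENNReal.coe_inv hs0.ne'] at h2
    have h3 : 1 + r < s⁻¹ := by exact_mod_cast h2
    rw [lt_inv_comm₀ (by positivity) hs0, ← one_div, lt_div_iff₀ (by positivity)] at h3
    exact_mod_cast h3
  · filter_upwards [eventually_lt_of_limsup_lt hr1, eventually_sum_pos hb] with n h2 h3
    rw [← ENNReal.ofReal_coe_nnreal, ENNReal.ofReal_lt_ofReal_iff'] at h2
    exact (div_le_iff₀ h3).1 h2.1.le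

theorem dimH_Lset {φ : ℕ → ℝ} (hpos : ∀ n, 0 < n → 0 < φ n)
    (hφ : Tendsto (fun n => Real.log (φ (n + 1)) - Real.log (φ n)) atTop atTop) :
    dimH (Lset φ) = 1 / (1 + partialSumRatio (altSum fun n => Real.log (φ n))) := by
  have hb := altSum_superlinear (ψ := fun n => Real.log (φ n)) hφ
  refine le_antisymm (le_of_forall_gt_imp_ge_of_dense fun s' hs' => ?_)
    (le_of_forall_lt_imp_le_of_dense fun s' hs' => ?_)
  · obtain ⟨s, hs, hss'⟩ := ENNReal.lt_iff_exists_nnreal_btwn.1 hs'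
    refine le_trans ?_ hss'.le
    obtain ⟨q, hq1, hq2⟩ := exists_frequently_mul_sum_le hb hs
    refine (dimH_mono fun x hx => mem_iUnion.2 (exists_mem_bandSet hpos hφ hx)).trans ?_
    rw [dimH_iUnion]
    exact iSup_le fun C => dimH_bandSet_le hb s q hq1 hq2 C C.cast_nonneg
  · lift s' to NNReal using hs'.ne_top
    rcases eq_or_ne s' 0 with rfl | h0
    · exact zero_le
    obtain ⟨r, hr0, hr1, hr2⟩ := exists_eventually_sum_le_mul hb (pos_iff_ne_zero.2 h0) hs'
    exact le_dimH_of_codedDigit hb (pos_iff_ne_zero.2 h0) hr0 hr1 hr2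
      fun y hy => cfLim_codedDigit_mem_Lset hpos hφ hy

/-- Theorem 1.2 (3): if `log φ` is regularly increasing with index `ρ ∈ (1, ∞]`,
then `dim_H L(φ) = 1/(1+β)`. -/
theorem statement2 (φ : ℝ → ℝ)
    (hφpos : ∀ x > (0 : ℝ), 0 < φ x)
    (hφmono : MonotoneOn φ (Ioi (0 : ℝ)))
    (hreg : (∃ ρ : ℝ, 1 < ρ ∧ RegInc (fun x => Real.log (φ x)) ρ) ∨
      RegIncTop (fun x => Real.log (φ x))) :
    dimH (Lset fun n : ℕ => φ n) = 1 / (1 + betaVal φ) := by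
  rw [betaVal_eq_partialSumRatio]
  exact dimH_Lset (fun n hn => hφpos n (Nat.cast_pos.2 hn))
    (tendsto_sub_of_regularly_increasing hreg)
end

section
/- Let R : ℝ⁺ → ℝ⁺ be a regularly increasing function with index 0 and let φ : ℝ⁺ → ℝ⁺ be an increasing function satisfying log φ(n) = √n / R(n) for all n. Then the Hausdorff dimension of L(φ) equals 1. -/
open Filter Set
open scoped ENNReal

open MeasureTheory in
/-- The Gauss measure `dx / (1 + x)`, without normalization. -/
noncomputable def gaussMeasure (A : Set ℝ) : ℝ≥0∞ :=
  ∫⁻ x in A, ENNReal.ofReal (1 / (1 + x))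

lemma measurable_gaussMap : Measurable gaussMap :=
  measurable_fract.comp (measurable_const.div measurable_id)

lemma tsum_gauss_branch_le {t : ℝ} (ht : 0 < t) :
    ∑' k : ℕ, ENNReal.ofReal |-(1 / (k + 1 + t) ^ 2)| *
      ENNReal.ofReal (1 / (1 + 1 / (k + 1 + t))) ≤ ENNReal.ofReal (1 / (1 + t)) := by
  have hterm : ∀ k : ℕ, ENNReal.ofReal |-(1 / (k + 1 + t) ^ 2)| *
      ENNReal.ofReal (1 / (1 + 1 / (k + 1 + t)))
      = ENNReal.ofReal (1 / (k + 1 + t) - 1 / ((k + 1 : ℕ) + 1 + t)) := by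
    intro k
    have hk : 0 < (k : ℝ) + 1 + t := by positivity
    rw [← ENNReal.ofReal_mul (abs_nonneg _), abs_neg, abs_of_pos (by positivity)]
    congr 1
    push_cast
    field_simp
    ring
  simp_rw [hterm]
  refine ENNReal.tsum_le_of_sum_range_le fun n => ?_
  rw [← ENNReal.ofReal_sum_of_nonneg]
  · apply ENNReal.ofReal_le_ofReal
    rw [Finset.sum_range_sub' (fun k : ℕ => 1 / ((k : ℝ) + 1 + t))]
    have : 0 ≤ 1 / ((n : ℝ) + 1 + t) := by positivity
    simp only [Nat.cast_zero, zero_add]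
    linarith
  · intro k _
    rw [sub_nonneg]
    apply one_div_le_one_div_of_le (by positivity)
    push_cast
    linarith

open MeasureTheory in
lemma gaussMeasure_preimage_le {A : Set ℝ} (hA : MeasurableSet A) (hsub : A ⊆ Ioo 0 1) :
    gaussMeasure (Ioo 0 1 ∩ gaussMap ⁻¹' A) ≤ gaussMeasure A := by
  have hcover : Ioo 0 1 ∩ gaussMap ⁻¹' A ⊆ ⋃ k : ℕ, (fun t : ℝ => 1 / (k + 1 + t)) '' A := by
    rintro x ⟨⟨hx0, hx1⟩, hxA⟩
    have h1 : 1 ≤ 1 / x := by rw [le_div_iff₀ hx0]; linarith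
    have hfl : 1 ≤ ⌊1 / x⌋₊ := Nat.one_le_floor_iff _ |>.2 h1
    refine mem_iUnion.2 ⟨⌊1 / x⌋₊ - 1, gaussMap x, hxA, ?_⟩
    have h2 : ((⌊1 / x⌋₊ - 1 : ℕ) : ℝ) + 1 = ⌊1 / x⌋₊ := by
      rw [Nat.cast_sub hfl]; simp
    have h3 : ((⌊1 / x⌋₊ : ℕ) : ℝ) + gaussMap x = 1 / x := by
      rw [gaussMap, natCast_floor_eq_intCast_floor (by positivity), Int.floor_add_fract]
    simp only [h2, h3, one_div_one_div]
  calc gaussMeasure (Ioo 0 1 ∩ gaussMap ⁻¹' A)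
      ≤ ∫⁻ x in ⋃ k : ℕ, (fun t : ℝ => 1 / (k + 1 + t)) '' A, ENNReal.ofReal (1 / (1 + x)) :=
        lintegral_mono_set hcover
    _ ≤ ∑' k : ℕ, ∫⁻ x in (fun t : ℝ => 1 / (k + 1 + t)) '' A, ENNReal.ofReal (1 / (1 + x)) :=
        lintegral_iUnion_le _ _
    _ = ∑' k : ℕ, ∫⁻ t in A, ENNReal.ofReal |-(1 / (k + 1 + t) ^ 2)| *
          ENNReal.ofReal (1 / (1 + 1 / (k + 1 + t))) := by
        congr 1 with k
        refine lintegral_image_eq_lintegral_abs_deriv_mul hA (fun t ht => ?_) ?_ _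
        · have ht0 := (hsub ht).1
          have hne : (k : ℝ) + 1 + t ≠ 0 := by positivity
          have := ((hasDerivAt_id t).const_add ((k : ℝ) + 1)).inv hne
          simp only [one_div]
          refine HasDerivAt.hasDerivWithinAt (this.congr_deriv ?_)
          simp [neg_div]
        · intro s hs t ht hst
          have hs0 := (hsub hs).1
          have ht0 := (hsub ht).1
          simp only [one_div, inv_inj] at hst
          linarith
    _ = ∫⁻ t in A, ∑' k : ℕ, ENNReal.ofReal |-(1 / (k + 1 + t) ^ 2)| *
          ENNReal.ofReal (1 / (1 + 1 / (k + 1 + t))) := by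
        rw [lintegral_tsum]
        intro k
        fun_prop
    _ ≤ gaussMeasure A :=
        setLIntegral_mono (by fun_prop) fun t ht => tsum_gauss_branch_le (hsub ht).1

/-- Points of `(0,1)` whose first `n` Gauss iterates stay in `(0,1)` and whose `n`-th
iterate lies in `(0,δ)`. -/
def smallIterate (δ : ℝ) : ℕ → Set ℝ
  | 0 => Ioo 0 δ
  | n + 1 => Ioo 0 1 ∩ gaussMap ⁻¹' smallIterate δ n

lemma smallIterate_subset {δ : ℝ} (hδ : δ ≤ 1) : ∀ n, smallIterate δ n ⊆ Ioo 0 1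
  | 0 => Ioo_subset_Ioo_right hδ
  | _ + 1 => inter_subset_left

lemma measurableSet_smallIterate (δ : ℝ) : ∀ n, MeasurableSet (smallIterate δ n)
  | 0 => measurableSet_Ioo
  | n + 1 => measurableSet_Ioo.inter (measurable_gaussMap (measurableSet_smallIterate δ n))

open MeasureTheory in
lemma volume_smallIterate_le {δ : ℝ} (hδ : δ ≤ 1) (n : ℕ) :
    volume (smallIterate δ n) ≤ ENNReal.ofReal (2 * δ) := by
  have hγ : ∀ n, gaussMeasure (smallIterate δ n) ≤ ENNReal.ofReal δ := by
    intro n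
    induction n with
    | zero =>
      calc gaussMeasure (Ioo 0 δ) ≤ ∫⁻ _ in Ioo (0 : ℝ) δ, 1 := by
            refine setLIntegral_mono (by fun_prop) fun x hx => ?_
            rw [ENNReal.ofReal_le_one, div_le_one (by linarith [hx.1])]
            linarith [hx.1]
        _ = ENNReal.ofReal δ := by simp
    | succ n ih =>
      exact (gaussMeasure_preimage_le (measurableSet_smallIterate δ n)
        (smallIterate_subset hδ n)).trans ih
  calc volume (smallIterate δ n) = ∫⁻ _ in smallIterate δ n, 1 := by simp
    _ ≤ ∫⁻ x in smallIterate δ n, 2 * ENNReal.ofReal (1 / (1 + x)) := by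
        refine setLIntegral_mono (by fun_prop) fun x hx => ?_
        have hx' := smallIterate_subset hδ n hx
        rw [show (2 : ℝ≥0∞) = ENNReal.ofReal 2 by simp, ← ENNReal.ofReal_mul (by norm_num),
          ENNReal.one_le_ofReal, mul_one_div, le_div_iff₀ (by linarith [hx'.1])]
        linarith [hx'.2]
    _ = 2 * gaussMeasure (smallIterate δ n) := by
        rw [lintegral_const_mul _ (by fun_prop), gaussMeasure]
    _ ≤ 2 * ENNReal.ofReal δ := by gcongr; exact hγ n
    _ = ENNReal.ofReal (2 * δ) := by rw [ENNReal.ofReal_mul (by norm_num)]; simp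

/-- All Gauss iterates of `x` lie in the open unit interval. -/
def IsCFPoint (x : ℝ) : Prop := ∀ n, gaussMap^[n] x ∈ Ioo (0 : ℝ) 1

lemma irrational_gaussMap {x : ℝ} (hx : Irrational x) : Irrational (gaussMap x) := by
  have h : Irrational (1 / x) := by simpa using irrational_inv_iff.2 hx
  exact h.sub_intCast ⌊1 / x⌋

lemma isCFPoint_of_irrational {x : ℝ} (hx : Irrational x) (h01 : x ∈ Ioo (0 : ℝ) 1) :
    IsCFPoint x := by
  have hirr : ∀ n, Irrational (gaussMap^[n] x) := by
    intro n
    induction n with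
    | zero => simpa using hx
    | succ n ih => rw [Function.iterate_succ_apply']; exact irrational_gaussMap ih
  intro n
  cases n with
  | zero => simpa using h01
  | succ n =>
    have h := hirr (n + 1)
    rw [Function.iterate_succ_apply'] at h ⊢
    exact ⟨lt_of_le_of_ne (Int.fract_nonneg _) fun h0 => h.ne_zero h0.symm, Int.fract_lt_one _⟩

/-- The growth bound imposed on the free digits. -/
def digitBound (n : ℕ) : ℕ := 4 * (n + 1) * (n + 2)

/-- Points whose digits grow at most polynomially. -/
def tameSet : Set ℝ :=
  {x | x ∈ Ioo (0 : ℝ) 1 ∧ Irrational x ∧ ∀ n, 1 / (digitBound n : ℝ) ≤ gaussMap^[n] x}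

lemma mem_smallIterate {δ : ℝ} : ∀ {n : ℕ} {x : ℝ}, IsCFPoint x → gaussMap^[n] x < δ →
    x ∈ smallIterate δ n
  | 0, _, hx, h => ⟨(hx 0).1, h⟩
  | n + 1, _, hx, h => ⟨hx 0, mem_smallIterate (n := n) (fun k => hx (k + 1)) h⟩

open MeasureTheory in
lemma volume_tameSet_ne_zero : volume tameSet ≠ 0 := by
  intro h0
  have hcover : Ioo (0 : ℝ) 1 ⊆ (tameSet ∪ range ((↑) : ℚ → ℝ)) ∪
      ⋃ n, smallIterate (1 / (digitBound n : ℝ)) n := by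
    intro x hx
    by_cases hirr : Irrational x
    · by_cases hall : ∀ n, 1 / (digitBound n : ℝ) ≤ gaussMap^[n] x
      · exact Or.inl (Or.inl ⟨hx, hirr, hall⟩)
      · push Not at hall
        obtain ⟨n, hn⟩ := hall
        exact Or.inr (mem_iUnion.2 ⟨n, mem_smallIterate (isCFPoint_of_irrational hirr hx) hn⟩)
    · exact Or.inl (Or.inr (by simpa [Irrational] using hirr))
  have hQ : volume (range ((↑) : ℚ → ℝ)) = 0 := (countable_range _).measure_zero _
  have hsum : ∑' n, volume (smallIterate (1 / (digitBound n : ℝ)) n) ≤ ENNReal.ofReal (1 / 2) := by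
    calc ∑' n, volume (smallIterate (1 / (digitBound n : ℝ)) n)
        ≤ ∑' n : ℕ, ENNReal.ofReal (1 / 2 * (1 / (n + 1)) - 1 / 2 * (1 / ((n + 1 : ℕ) + 1))) := by
          refine ENNReal.tsum_le_tsum fun n => ?_
          refine (volume_smallIterate_le ?_ n).trans (ENNReal.ofReal_le_ofReal (le_of_eq ?_))
          · rw [div_le_one (by simp only [digitBound]; positivity)]
            exact_mod_cast (by simp only [digitBound]; positivity : 0 < digitBound n)
          · simp only [digitBound]
            push_cast
            field_simp
            ring
      _ ≤ ENNReal.ofReal (1 / 2) := by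
          refine ENNReal.tsum_le_of_sum_range_le fun n => ?_
          rw [← ENNReal.ofReal_sum_of_nonneg]
          · apply ENNReal.ofReal_le_ofReal
            rw [Finset.sum_range_sub' (fun k : ℕ => 1 / 2 * (1 / ((k : ℝ) + 1)))]
            have : 0 ≤ 1 / 2 * (1 / ((n : ℝ) + 1)) := by positivity
            simp only [Nat.cast_zero, zero_add]
            linarith
          · intro k _
            rw [sub_nonneg]
            gcongr
            linarith
  have h1 : (1 : ℝ≥0∞) ≤ ENNReal.ofReal (1 / 2) := by
    calc (1 : ℝ≥0∞) = volume (Ioo (0 : ℝ) 1) := by simp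
      _ ≤ volume (tameSet ∪ range ((↑) : ℚ → ℝ)) +
          volume (⋃ n, smallIterate (1 / (digitBound n : ℝ)) n) :=
          (measure_mono hcover).trans (measure_union_le _ _)
      _ ≤ (volume tameSet + volume (range ((↑) : ℚ → ℝ))) +
          ∑' n, volume (smallIterate (1 / (digitBound n : ℝ)) n) :=
          add_le_add (measure_union_le _ _) (measure_iUnion_le _)
      _ ≤ ENNReal.ofReal (1 / 2) := by rw [h0, hQ]; simpa using hsum
  rw [ENNReal.one_le_ofReal] at h1
  norm_num at h1

open MeasureTheory in
lemma one_le_dimH_tameSet : 1 ≤ dimH tameSet := by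
  have h : μH[((1 : NNReal) : ℝ)] tameSet ≠ 0 := by
    simpa [hausdorffMeasure_real] using volume_tameSet_ne_zero
  simpa using le_dimH_of_hausdorffMeasure_ne_zero h

/-- The finite continued fraction `[a 0, …, a (n - 1) + t]`. -/
noncomputable def cfEval (a : ℕ → ℕ) : ℕ → ℝ → ℝ
  | 0, t => t
  | n + 1, t => cfEval a n (1 / (a n + t))

/-- The denominators of the convergents, shifted so that `cfDen a 0 = 0`, `cfDen a 1 = 1`. -/
def cfDen (a : ℕ → ℕ) : ℕ → ℕ
  | 0 => 0
  | 1 => 1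
  | n + 2 => a n * cfDen a (n + 1) + cfDen a n

lemma cfEval_succ' (a : ℕ → ℕ) (n : ℕ) (t : ℝ) :
    cfEval a (n + 1) t = 1 / (a 0 + cfEval (fun i => a (i + 1)) n t) := by
  induction n generalizing t with
  | zero => rfl
  | succ n ih => rw [cfEval, ih]; rfl

lemma cfEval_congr {a b : ℕ → ℕ} {n : ℕ} (h : ∀ i < n, a i = b i) (t : ℝ) :
    cfEval a n t = cfEval b n t := by
  induction n generalizing t with
  | zero => rfl
  | succ n ih => rw [cfEval, cfEval, h n n.lt_succ_self, ih fun i hi => h i (hi.trans n.lt_succ_self)]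

section Positive

variable {a : ℕ → ℕ}

lemma cfDen_succ_pos (ha : ∀ i, 1 ≤ a i) : ∀ n, 0 < cfDen a (n + 1)
  | 0 => Nat.one_pos
  | n + 1 => Nat.add_pos_left (Nat.mul_pos (ha n) (cfDen_succ_pos ha n)) _

lemma cfDen_le_succ (ha : ∀ i, 1 ≤ a i) : ∀ n, cfDen a n ≤ cfDen a (n + 1)
  | 0 => Nat.zero_le _
  | n + 1 => (Nat.le_mul_of_pos_left _ (ha n)).trans (Nat.le_add_right _ _)

lemma cfDen_growth (ha : ∀ i, 1 ≤ a i) (n : ℕ) :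
    2 / 3 * (3 / 2 : ℝ) ^ n ≤ cfDen a (n + 1) := by
  have hboth : 2 / 3 * (3 / 2 : ℝ) ^ n ≤ cfDen a (n + 1) ∧
      2 / 3 * (3 / 2 : ℝ) ^ (n + 1) ≤ cfDen a (n + 2) := by
    induction n with
    | zero =>
      have : (1 : ℝ) ≤ a 0 := by exact_mod_cast ha 0
      simp only [cfDen]
      norm_num
      exact ha 0
    | succ n ih =>
      refine ⟨ih.2, ?_⟩
      have h1 : (1 : ℝ) ≤ a (n + 1) := by exact_mod_cast ha (n + 1)
      have h2 : (cfDen a (n + 3) : ℝ) = a (n + 1) * cfDen a (n + 2) + cfDen a (n + 1) := by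
        rw [cfDen]; push_cast; ring
      have h3 : (cfDen a (n + 2) : ℝ) ≤ a (n + 1) * cfDen a (n + 2) :=
        le_mul_of_one_le_left (Nat.cast_nonneg _) h1
      have h4 : (0 : ℝ) < (3 / 2 : ℝ) ^ n := by positivity
      rw [h2]
      have h5 : (3 / 2 : ℝ) ^ (n + 1 + 1) = 9 / 4 * (3 / 2) ^ n := by ring
      have h6 : (3 / 2 : ℝ) ^ (n + 1) = 3 / 2 * (3 / 2) ^ n := by ring
      rw [h6] at ih
      rw [h5]
      linarith [ih.1, ih.2]
  exact hboth.1

lemma abs_cfEval_sub_mul (ha : ∀ i, 1 ≤ a i) (n : ℕ) {s t : ℝ} (hs : 0 ≤ s) (ht : 0 ≤ t) :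
    |cfEval a n s - cfEval a n t| *
      ((cfDen a (n + 1) + cfDen a n * s) * (cfDen a (n + 1) + cfDen a n * t)) = |s - t| := by
  induction n generalizing s t with
  | zero => simp [cfEval, cfDen]
  | succ n ih =>
    have hA : (1 : ℝ) ≤ a n := by exact_mod_cast ha n
    have hs' : 0 < (a n : ℝ) + s := by linarith
    have ht' : 0 < (a n : ℝ) + t := by linarith
    have h := ih (s := 1 / (a n + s)) (t := 1 / (a n + t)) (by positivity) (by positivity)
    have hdiff : |1 / ((a n : ℝ) + s) - 1 / (a n + t)| * ((a n + s) * (a n + t)) = |s - t| := by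
      nth_rewrite 1 [← abs_of_pos (mul_pos hs' ht')]
      rw [← abs_mul, abs_sub_comm s]
      congr 1
      field_simp
      ring
    have hden : ∀ u : ℝ, 0 < (a n : ℝ) + u → (cfDen a (n + 2) : ℝ) + cfDen a (n + 1) * u
        = (a n + u) * (cfDen a (n + 1) + cfDen a n * (1 / (a n + u))) := by
      intro u hu
      simp only [cfDen]
      push_cast
      field_simp
      ring
    rw [hden s hs', hden t ht', ← hdiff, ← h]
    simp only [cfEval]
    ring

lemma abs_cfEval_sub_le (ha : ∀ i, 1 ≤ a i) (n : ℕ) {s t : ℝ} (hs : s ∈ Icc (0 : ℝ) 1)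
    (ht : t ∈ Icc (0 : ℝ) 1) :
    |cfEval a n s - cfEval a n t| ≤ 1 / (cfDen a (n + 1) : ℝ) ^ 2 := by
  have hq : (0 : ℝ) < cfDen a (n + 1) := by exact_mod_cast cfDen_succ_pos ha n
  have hq' : (0 : ℝ) ≤ cfDen a n := Nat.cast_nonneg _
  rw [le_div_iff₀ (by positivity)]
  calc |cfEval a n s - cfEval a n t| * (cfDen a (n + 1) : ℝ) ^ 2
      ≤ |cfEval a n s - cfEval a n t| *
      ((cfDen a (n + 1) + cfDen a n * s) * (cfDen a (n + 1) + cfDen a n * t)) := by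
        rw [sq]
        have := hs.1
        have := ht.1
        gcongr
        · exact le_add_of_nonneg_right (by positivity)
        · exact le_add_of_nonneg_right (by positivity)
    _ = |s - t| := abs_cfEval_sub_mul ha n hs.1 ht.1
    _ ≤ 1 := abs_sub_le_iff.2 ⟨by linarith [hs.2, ht.1], by linarith [hs.1, ht.2]⟩

lemma le_abs_cfEval_sub (ha : ∀ i, 1 ≤ a i) (n : ℕ) {s t : ℝ} (hs : s ∈ Icc (0 : ℝ) 1)
    (ht : t ∈ Icc (0 : ℝ) 1) :
    |s - t| / (4 * (cfDen a (n + 1) : ℝ) ^ 2) ≤ |cfEval a n s - cfEval a n t| := by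
  have hq : (0 : ℝ) < cfDen a (n + 1) := by exact_mod_cast cfDen_succ_pos ha n
  have hq' : (0 : ℝ) ≤ cfDen a n := Nat.cast_nonneg _
  have hqq : (cfDen a n : ℝ) ≤ cfDen a (n + 1) := by exact_mod_cast cfDen_le_succ ha n
  have hbd : ∀ u ∈ Icc (0 : ℝ) 1,
      (cfDen a (n + 1) : ℝ) + cfDen a n * u ≤ 2 * cfDen a (n + 1) := fun u hu => by
    have := mul_le_of_le_one_right hq' hu.2
    linarith
  have hnn : ∀ u ∈ Icc (0 : ℝ) 1, 0 ≤ (cfDen a (n + 1) : ℝ) + cfDen a n * u := fun u hu => by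
    have := hu.1
    positivity
  rw [div_le_iff₀ (by positivity), ← abs_cfEval_sub_mul ha n hs.1 ht.1]
  refine mul_le_mul_of_nonneg_left ?_ (abs_nonneg _)
  calc _ ≤ (2 * (cfDen a (n + 1) : ℝ)) * (2 * cfDen a (n + 1)) :=
        mul_le_mul (hbd s hs) (hbd t ht) (hnn t ht) (by positivity)
    _ = _ := by ring

lemma cfEval_nonneg (n : ℕ) {t : ℝ} (ht : 0 ≤ t) : 0 ≤ cfEval a n t := by
  induction n generalizing t with
  | zero => exact ht
  | succ n ih => exact ih (by positivity)

lemma exists_tendsto_cfEval (ha : ∀ i, 1 ≤ a i) :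
    ∃ x, Tendsto (fun n => cfEval a n 0) atTop (nhds x) := by
  refine cauchySeq_tendsto_of_complete
    (cauchySeq_of_le_geometric (4 / 9) (9 / 4) (by norm_num) fun n => ?_)
  have hA : (1 : ℝ) ≤ a n := by exact_mod_cast ha n
  have hq := cfDen_growth ha n
  rw [dist_comm, Real.dist_eq]
  calc |cfEval a (n + 1) 0 - cfEval a n 0| ≤ 1 / (cfDen a (n + 1) : ℝ) ^ 2 :=
        abs_cfEval_sub_le ha n
          ⟨by positivity, by rw [add_zero, div_le_one (by linarith)]; exact hA⟩ (by simp)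
    _ ≤ 1 / (2 / 3 * (3 / 2 : ℝ) ^ n) ^ 2 := by gcongr
    _ = 9 / 4 * (4 / 9) ^ n := by
        rw [mul_pow, ← pow_mul, mul_comm n 2, pow_mul, one_div, mul_inv, ← inv_pow _ n]
        norm_num

end Positive

/-- The value of the infinite continued fraction `[a 0, a 1, …]`. -/
noncomputable def cfVal (a : ℕ → ℕ) : ℝ := limUnder atTop fun n => cfEval a n 0

lemma tendsto_cfVal {a : ℕ → ℕ} (ha : ∀ i, 1 ≤ a i) :
    Tendsto (fun n => cfEval a n 0) atTop (nhds (cfVal a)) :=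
  tendsto_nhds_limUnder (exists_tendsto_cfEval ha)

lemma cfVal_nonneg {a : ℕ → ℕ} (ha : ∀ i, 1 ≤ a i) : 0 ≤ cfVal a :=
  ge_of_tendsto' (tendsto_cfVal ha) fun n => cfEval_nonneg n le_rfl

lemma cfVal_eq {a : ℕ → ℕ} (ha : ∀ i, 1 ≤ a i) :
    cfVal a = 1 / (a 0 + cfVal fun i => a (i + 1)) := by
  have ha' : ∀ i, 1 ≤ a (i + 1) := fun i => ha (i + 1)
  have hA : (1 : ℝ) ≤ a 0 := by exact_mod_cast ha 0
  have h0 := cfVal_nonneg ha'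
  refine tendsto_nhds_unique ((tendsto_add_atTop_iff_nat 1).2 (tendsto_cfVal ha)) ?_
  simp_rw [cfEval_succ']
  exact tendsto_const_nhds.div ((tendsto_cfVal ha').const_add _) (by positivity)

lemma cfVal_mem_Ioo {a : ℕ → ℕ} (ha : ∀ i, 1 ≤ a i) : cfVal a ∈ Ioo (0 : ℝ) 1 := by
  have hpos : ∀ {b : ℕ → ℕ}, (∀ i, 1 ≤ b i) → 0 < cfVal b := by
    intro b hb
    have hB : (1 : ℝ) ≤ b 0 := by exact_mod_cast hb 0
    have h0 := cfVal_nonneg fun i => hb (i + 1)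
    rw [cfVal_eq hb]
    positivity
  refine ⟨hpos ha, ?_⟩
  have hA : (1 : ℝ) ≤ a 0 := by exact_mod_cast ha 0
  have h1 := hpos fun i => ha (i + 1)
  rw [cfVal_eq ha, div_lt_one (by linarith)]
  linarith

lemma gaussMap_cfVal {a : ℕ → ℕ} (ha : ∀ i, 1 ≤ a i) :
    gaussMap (cfVal a) = cfVal fun i => a (i + 1) := by
  have h := cfVal_mem_Ioo fun i => ha (i + 1)
  rw [gaussMap, cfVal_eq ha, one_div_one_div, Int.fract_natCast_add, Int.fract_eq_self.2]
  exact ⟨h.1.le, h.2⟩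

lemma gaussMap_iterate_cfVal {a : ℕ → ℕ} (ha : ∀ i, 1 ≤ a i) (n : ℕ) :
    gaussMap^[n] (cfVal a) = cfVal fun i => a (i + n) := by
  induction n with
  | zero => rfl
  | succ n ih =>
    rw [Function.iterate_succ_apply', ih, gaussMap_cfVal fun i => ha (i + n)]
    congr 1
    funext i
    congr 1
    ring

lemma pq_cfVal {a : ℕ → ℕ} (ha : ∀ i, 1 ≤ a i) (n : ℕ) : pq (cfVal a) (n + 1) = a n := by
  have h := cfVal_mem_Ioo fun i => ha (i + 1 + n)
  rw [pq, Nat.add_sub_cancel, gaussMap_iterate_cfVal ha, cfVal_eq fun i => ha (i + n),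
    one_div_one_div, zero_add, add_comm, Nat.floor_add_natCast h.1.le, Nat.floor_eq_zero.2 h.2, zero_add]

lemma isCFPoint_cfVal {a : ℕ → ℕ} (ha : ∀ i, 1 ≤ a i) : IsCFPoint (cfVal a) := fun n => by
  rw [gaussMap_iterate_cfVal ha]
  exact cfVal_mem_Ioo fun i => ha (i + n)

namespace IsCFPoint

variable {x : ℝ}

lemma iterate_eq (hx : IsCFPoint x) (n : ℕ) :
    gaussMap^[n] x = 1 / (pq x (n + 1) + gaussMap^[n + 1] x) := by
  have h := hx n
  rw [Function.iterate_succ_apply', pq, Nat.add_sub_cancel, gaussMap,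
    natCast_floor_eq_intCast_floor (one_div_nonneg.2 h.1.le), Int.floor_add_fract, one_div_one_div]

lemma one_le_pq (hx : IsCFPoint x) (n : ℕ) : 1 ≤ pq x (n + 1) := by
  have h := hx n
  rw [pq, Nat.add_sub_cancel, Nat.one_le_floor_iff, le_div_iff₀ h.1]
  linarith [h.2]

lemma eq_cfEval (hx : IsCFPoint x) (n : ℕ) :
    x = cfEval (fun i => pq x (i + 1)) n (gaussMap^[n] x) := by
  induction n with
  | zero => rfl
  | succ n ih => rw [cfEval, ← hx.iterate_eq, ← ih]

lemma iterate_mem_Icc (hx : IsCFPoint x) (n : ℕ) : gaussMap^[n] x ∈ Icc (0 : ℝ) 1 :=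
  Ioo_subset_Icc_self (hx n)

lemma abs_sub_eq {y : ℝ} (hx : IsCFPoint x) (hy : IsCFPoint y) {n : ℕ}
    (h : ∀ i < n, pq x (i + 1) = pq y (i + 1)) :
    |x - y| = |cfEval (fun i => pq x (i + 1)) n (gaussMap^[n] x) -
      cfEval (fun i => pq x (i + 1)) n (gaussMap^[n] y)| := by
  rw [cfEval_congr h (gaussMap^[n] y), ← hx.eq_cfEval, ← hy.eq_cfEval]

/-- Two points sharing their first `n` digits are close. -/
lemma abs_sub_le {y : ℝ} (hx : IsCFPoint x) (hy : IsCFPoint y) {n : ℕ}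
    (h : ∀ i < n, pq x (i + 1) = pq y (i + 1)) :
    |x - y| ≤ 1 / (cfDen (fun i => pq x (i + 1)) (n + 1) : ℝ) ^ 2 := by
  rw [hx.abs_sub_eq hy h]
  exact abs_cfEval_sub_le hx.one_le_pq n (hx.iterate_mem_Icc n) (hy.iterate_mem_Icc n)

/-- Two points whose digits first differ in place `n` are far apart. -/
lemma le_abs_sub {y : ℝ} (hx : IsCFPoint x) (hy : IsCFPoint y) {n B : ℕ}
    (h : ∀ i < n, pq x (i + 1) = pq y (i + 1)) (hne : pq x (n + 1) ≠ pq y (n + 1))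
    (hBx : ∀ i ≤ n + 1, pq x (i + 1) ≤ B) (hBy : ∀ i ≤ n + 1, pq y (i + 1) ≤ B) :
    1 / (4 * (B + 1 : ℝ) ^ 3 * (cfDen (fun i => pq x (i + 1)) (n + 1) : ℝ) ^ 2) ≤ |x - y| := by
  have hgap : ∀ {z : ℝ}, IsCFPoint z → (∀ i ≤ n + 1, pq z (i + 1) ≤ B) →
      1 / (B + 1 : ℝ) ≤ gaussMap^[n + 1] z := by
    intro z hz hBz
    rw [hz.iterate_eq (n + 1)]
    have h1 : (pq z (n + 1 + 1) : ℝ) ≤ B := by exact_mod_cast hBz (n + 1) le_rfl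
    have h2 := hz (n + 1 + 1)
    have h3 : (0 : ℝ) ≤ pq z (n + 1 + 1) := Nat.cast_nonneg _
    exact one_div_le_one_div_of_le (by linarith [h2.1]) (by linarith [h2.2])
  have hsep : 1 / (B + 1 : ℝ) ≤
      |((pq x (n + 1) : ℝ) + gaussMap^[n + 1] x) - (pq y (n + 1) + gaussMap^[n + 1] y)| := by
    have hx1 := hx (n + 1)
    have hy1 := hy (n + 1)
    rcases lt_or_gt_of_ne hne with hlt | hlt
    · have h1 : (pq x (n + 1) : ℝ) + 1 ≤ pq y (n + 1) := by exact_mod_cast hlt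
      rw [abs_sub_comm]
      refine le_trans ?_ (le_abs_self _)
      linarith [hgap hy hBy, hx1.2]
    · have h1 : (pq y (n + 1) : ℝ) + 1 ≤ pq x (n + 1) := by exact_mod_cast hlt
      refine le_trans ?_ (le_abs_self _)
      linarith [hgap hx hBx, hy1.2]
  have hden : ∀ {z : ℝ}, IsCFPoint z → (∀ i ≤ n + 1, pq z (i + 1) ≤ B) →
      0 < (pq z (n + 1) : ℝ) + gaussMap^[n + 1] z ∧
      (pq z (n + 1) : ℝ) + gaussMap^[n + 1] z ≤ B + 1 := by
    intro z hz hBz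
    have h1 : (pq z (n + 1) : ℝ) ≤ B := by exact_mod_cast hBz n n.le_succ
    have h2 := hz (n + 1)
    have h3 : (0 : ℝ) ≤ pq z (n + 1) := Nat.cast_nonneg _
    exact ⟨by linarith [h2.1], by linarith [h2.2]⟩
  obtain ⟨hu0, hu⟩ := hden hx hBx
  obtain ⟨hv0, hv⟩ := hden hy hBy
  have hst : 1 / (B + 1 : ℝ) ^ 3 ≤ |gaussMap^[n] x - gaussMap^[n] y| := by
    rw [hx.iterate_eq n, hy.iterate_eq n, div_sub_div _ _ hu0.ne' hv0.ne', one_mul, mul_one,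
      abs_div, abs_sub_comm, abs_of_pos (mul_pos hu0 hv0)]
    calc 1 / (B + 1 : ℝ) ^ 3 = 1 / (B + 1 : ℝ) / ((B + 1) * (B + 1)) := by field_simp
      _ ≤ _ := by gcongr
  rw [hx.abs_sub_eq hy h]
  refine le_trans ?_ (le_abs_cfEval_sub hx.one_le_pq n (hx.iterate_mem_Icc n)
    (hy.iterate_mem_Icc n))
  have hq : (0 : ℝ) < cfDen (fun i => pq x (i + 1)) (n + 1) := by
    exact_mod_cast cfDen_succ_pos hx.one_le_pq n
  calc _ = 1 / (B + 1 : ℝ) ^ 3 / (4 * (cfDen (fun i => pq x (i + 1)) (n + 1) : ℝ) ^ 2) := by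
        field_simp
    _ ≤ _ := by gcongr

lemma exists_first_diff {y : ℝ} (hx : IsCFPoint x) (hy : IsCFPoint y) (hne : x ≠ y) :
    ∃ m, (∀ i < m, pq x (i + 1) = pq y (i + 1)) ∧ pq x (m + 1) ≠ pq y (m + 1) := by
  have hex : ∃ m, pq x (m + 1) ≠ pq y (m + 1) := by
    by_contra! hall
    have hlim : Tendsto (fun n : ℕ => 9 / 4 * (4 / 9 : ℝ) ^ n) atTop (nhds 0) := by
      simpa using (tendsto_pow_atTop_nhds_zero_of_lt_one (by norm_num)
        (by norm_num : (4 / 9 : ℝ) < 1)).const_mul (9 / 4)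
    have hle : |x - y| ≤ 0 := by
      refine ge_of_tendsto' hlim fun n => ?_
      have hq := cfDen_growth hx.one_le_pq n
      calc |x - y| ≤ 1 / (cfDen (fun i => pq x (i + 1)) (n + 1) : ℝ) ^ 2 :=
            hx.abs_sub_le hy fun i _ => hall i
        _ ≤ 1 / (2 / 3 * (3 / 2 : ℝ) ^ n) ^ 2 := by gcongr
        _ = 9 / 4 * (4 / 9) ^ n := by
          rw [mul_pow, ← pow_mul, mul_comm n 2, pow_mul, one_div, mul_inv, ← inv_pow _ n]
          norm_num
    exact hne (sub_eq_zero.1 (abs_nonpos_iff.1 hle))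
  classical
  exact ⟨Nat.find hex, fun i hi => not_not.1 (Nat.find_min hex hi), Nat.find_spec hex⟩

end IsCFPoint

/-- Inserting digits bounded by `B` multiplies denominators by at most `B + 1` per insertion. -/
lemma cfDen_insert_le {p : ℕ → Prop} [DecidablePred p] (hp0 : p 0) {a b : ℕ → ℕ} {B : ℕ}
    (hab : ∀ j, p j → b j = a (Nat.count p j)) {n : ℕ}
    (ha : ∀ i < n, a i ≤ B) (hb : ∀ j < n, b j ≤ B) (hapos : ∀ i, 1 ≤ a i) :
    cfDen b (n + 1) ≤ (B + 1) ^ (n - Nat.count p n) * cfDen a (Nat.count p n + 1) := by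
  have hcount : ∀ n, Nat.count p n ≤ n := fun _ => Nat.count_le p
  have hboth : cfDen b (n + 1) ≤ (B + 1) ^ (n - Nat.count p n) * cfDen a (Nat.count p n + 1) ∧
      cfDen b n ≤ (B + 1) ^ (n - Nat.count p n) * cfDen a (Nat.count p n) := by
    induction n with
    | zero => simp [cfDen]
    | succ n ih =>
      obtain ⟨h1, h2⟩ := ih (fun i hi => ha i (by omega)) fun j hj => hb j (by omega)
      have hn := hcount n
      set m := Nat.count p n with hm
      by_cases hpn : p n
      · have hcs : Nat.count p (n + 1) = m + 1 := by rw [Nat.count_succ, if_pos hpn]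
        rw [hcs, Nat.add_sub_add_right]
        refine ⟨?_, h1⟩
        calc cfDen b (n + 1 + 1) = a m * cfDen b (n + 1) + cfDen b n := by
              rw [cfDen, hab n hpn]
          _ ≤ a m * ((B + 1) ^ (n - m) * cfDen a (m + 1)) + (B + 1) ^ (n - m) * cfDen a m := by
              gcongr
          _ = (B + 1) ^ (n - m) * cfDen a (m + 1 + 1) := by rw [cfDen]; ring
      · have hcs : Nat.count p (n + 1) = m := by rw [Nat.count_succ, if_neg hpn, add_zero]
        rw [hcs, Nat.sub_add_comm hn, pow_succ]
        have hmpos : 1 ≤ m := by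
          have hn0 : 0 < n := Nat.pos_of_ne_zero fun h => hpn (h ▸ hp0)
          calc 1 = Nat.count p 1 := by rw [Nat.count_succ, if_pos hp0, Nat.count_zero]
            _ ≤ m := Nat.count_monotone p hn0
        constructor
        · calc cfDen b (n + 1 + 1) = b n * cfDen b (n + 1) + cfDen b n := by rw [cfDen]
            _ ≤ B * ((B + 1) ^ (n - m) * cfDen a (m + 1)) +
                (B + 1) ^ (n - m) * cfDen a (m + 1) := by
                gcongr
                · exact hb n n.lt_succ_self
                · exact h2.trans (Nat.mul_le_mul_left _ (cfDen_le_succ hapos m))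
            _ = _ := by ring
        · obtain ⟨l, hl⟩ : ∃ l, m = l + 1 := ⟨m - 1, by omega⟩
          have hq : cfDen a (m + 1) ≤ (B + 1) * cfDen a m := by
            rw [hl, cfDen]
            calc a l * cfDen a (l + 1) + cfDen a l ≤ B * cfDen a (l + 1) + cfDen a (l + 1) :=
                  Nat.add_le_add (Nat.mul_le_mul_right _ (ha l (by omega))) (cfDen_le_succ hapos l)
              _ = _ := by ring
          calc cfDen b (n + 1) ≤ (B + 1) ^ (n - m) * ((B + 1) * cfDen a m) :=
                h1.trans (Nat.mul_le_mul_left _ hq)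
            _ = _ := by ring
  exact hboth.1

/-- Places carrying a large digit. -/
def IsCenter (j : ℕ) : Prop := ∃ k, 2 ≤ k ∧ j = k ^ 2

/-- Places neither carrying a large digit nor adjacent to one. -/
def IsFree (j : ℕ) : Prop :=
  ∀ k, 2 ≤ k → j + 1 ≠ k ^ 2 ∧ j ≠ k ^ 2 ∧ j ≠ k ^ 2 + 1

lemma isFree_zero : IsFree 0 := fun k hk => by
  have : 4 ≤ k ^ 2 := by nlinarith
  omega

lemma isFree_sq_add_two {k : ℕ} (hk : 2 ≤ k) : IsFree (k ^ 2 + 2) := fun l _ => by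
  rcases le_or_gt l k with h | h
  · have : l ^ 2 ≤ k ^ 2 := Nat.pow_le_pow_left h 2
    omega
  · have : (k + 1) ^ 2 ≤ l ^ 2 := Nat.pow_le_pow_left h 2
    have : (k + 1) ^ 2 = k ^ 2 + 2 * k + 1 := by ring
    omega

lemma infinite_isFree : (Set.ofPred IsFree).Infinite := by
  refine Set.infinite_of_not_bddAbove ?_
  rintro ⟨N, hN⟩
  have h := hN (isFree_sq_add_two (k := N + 2) (by omega))
  nlinarith

lemma sub_count_isFree_le [DecidablePred IsFree] (n : ℕ) :
    n - Nat.count IsFree n ≤ 3 * (Nat.sqrt n + 1) := by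
  have hsplit : Nat.count IsFree n + ((Finset.range n).filter fun j => ¬ IsFree j).card = n := by
    rw [Nat.count_eq_card_filter_range, Finset.card_filter_add_card_filter_not, Finset.card_range]
  have hsub : ((Finset.range n).filter fun j => ¬ IsFree j) ⊆
      (Finset.range 3 ×ˢ Finset.range (Nat.sqrt n + 1)).image fun q => q.2 ^ 2 + q.1 - 1 := by
    intro j hj
    rw [Finset.mem_filter, Finset.mem_range] at hj
    obtain ⟨hjn, hj⟩ := hj
    unfold IsFree at hj
    push Not at hj
    obtain ⟨k, hk, hkj⟩ := hj
    have h4 : 4 ≤ k ^ 2 := by nlinarith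
    have hex : ∃ e < 3, j = k ^ 2 + e - 1 := by
      by_cases h1 : j + 1 = k ^ 2
      · exact ⟨0, by omega, by omega⟩
      · by_cases h2 : j = k ^ 2
        · exact ⟨1, by omega, by omega⟩
        · exact ⟨2, by omega, by rw [hkj h1 h2]; omega⟩
    obtain ⟨e, he, hje⟩ := hex
    refine Finset.mem_image.2 ⟨(e, k), ?_, hje.symm⟩
    rw [Finset.mem_product, Finset.mem_range, Finset.mem_range]
    exact ⟨he, Nat.lt_succ_of_le (Nat.le_sqrt'.2 (by lia : k ^ 2 ≤ n))⟩
  have hcard := (Finset.card_le_card hsub).trans Finset.card_image_le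
  rw [Finset.card_product, Finset.card_range, Finset.card_range] at hcard
  omega

open Classical in
/-- The digit sequence `a` with the blocks `1, ⌈φ (k²)⌉, 1` inserted around the places `k²`. -/
noncomputable def insertDigits (φ : ℝ → ℝ) (a : ℕ → ℕ) (j : ℕ) : ℕ :=
  if IsCenter j then ⌈φ j⌉₊ else if IsFree j then a (Nat.count IsFree j) else 1

section Insert

variable {φ : ℝ → ℝ} {a : ℕ → ℕ}

lemma insertDigits_center {j : ℕ} (hj : IsCenter j) : insertDigits φ a j = ⌈φ j⌉₊ :=
  if_pos hj

open Classical in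
lemma insertDigits_free {j : ℕ} (hj : IsFree j) :
    insertDigits φ a j = a (Nat.count IsFree j) := by
  have hc : ¬ IsCenter j := fun ⟨k, hk, hjk⟩ => (hj k hk).2.1 hjk
  rw [insertDigits, if_neg hc, if_pos hj]

lemma not_isFree_succ {j : ℕ} (hj : IsCenter j) : ¬ IsFree (j + 1) := fun h => by
  obtain ⟨k, hk, rfl⟩ := hj
  exact (h k hk).2.2 rfl

lemma not_isFree_of_succ {j : ℕ} (hj : IsCenter (j + 1)) : ¬ IsFree j := fun h => by
  obtain ⟨k, hk, hjk⟩ := hj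
  exact (h k hk).1 hjk

lemma not_isCenter_succ {j : ℕ} (hj : IsCenter j) : ¬ IsCenter (j + 1) := by
  obtain ⟨k, hk, rfl⟩ := hj
  rintro ⟨l, hl, hkl⟩
  rcases le_or_gt l k with h | h
  · have : l ^ 2 ≤ k ^ 2 := Nat.pow_le_pow_left h 2
    omega
  · have : (k + 1) ^ 2 ≤ l ^ 2 := Nat.pow_le_pow_left h 2
    nlinarith

lemma insertDigits_succ_center {j : ℕ} (hj : IsCenter j) : insertDigits φ a (j + 1) = 1 := by
  rw [insertDigits, if_neg (not_isCenter_succ hj), if_neg (not_isFree_succ hj)]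

lemma insertDigits_of_succ_center {j : ℕ} (hj : IsCenter (j + 1)) : insertDigits φ a j = 1 := by
  rw [insertDigits, if_neg fun h => not_isCenter_succ h hj, if_neg (not_isFree_of_succ hj)]

lemma IsCenter.pos {j : ℕ} (hj : IsCenter j) : 0 < j := by
  obtain ⟨k, hk, rfl⟩ := hj
  positivity

lemma one_le_insertDigits (hφpos : ∀ x > (0 : ℝ), 0 < φ x) (ha : ∀ i, 1 ≤ a i) (j : ℕ) :
    1 ≤ insertDigits φ a j := by
  unfold insertDigits
  split_ifs with h
  · exact Nat.ceil_pos.2 (hφpos _ (by exact_mod_cast h.pos))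
  · exact ha _
  · exact le_rfl

lemma digitBound_mono : Monotone digitBound := fun m n h => by
  unfold digitBound
  gcongr

lemma one_le_digitBound (n : ℕ) : 1 ≤ digitBound n := by
  unfold digitBound
  nlinarith

lemma insertDigits_not_center_le (ha : ∀ i, a i ≤ digitBound i) {j : ℕ} (hj : ¬ IsCenter j) :
    insertDigits φ a j ≤ digitBound j := by
  classical
  rw [insertDigits, if_neg hj]
  split_ifs with h
  · exact (ha _).trans (digitBound_mono (Nat.count_le _))
  · exact one_le_digitBound j

lemma insertDigits_center_le (hφmono : MonotoneOn φ (Ioi (0 : ℝ))) {j n : ℕ} (hjn : j ≤ n)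
    (hj : IsCenter j) : insertDigits φ a j ≤ ⌈φ n⌉₊ := by
  have h0 : (0 : ℝ) < j := by exact_mod_cast hj.pos
  have h1 : (j : ℝ) ≤ n := by exact_mod_cast hjn
  rw [insertDigits_center hj]
  exact Nat.ceil_mono (hφmono h0 (h0.trans_le h1) h1)

/-- A bound for the digits of index at most `n + 1`. -/
noncomputable def insertBound (φ : ℝ → ℝ) (n : ℕ) : ℕ := ⌈φ (n + 1 : ℕ)⌉₊ + digitBound (n + 1)

lemma insertDigits_le (hφmono : MonotoneOn φ (Ioi (0 : ℝ))) (ha : ∀ i, a i ≤ digitBound i)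
    {j n : ℕ} (hj : j ≤ n + 1) : insertDigits φ a j ≤ insertBound φ n := by
  by_cases hc : IsCenter j
  · exact (insertDigits_center_le hφmono hj hc).trans (Nat.le_add_right _ _)
  · exact ((insertDigits_not_center_le ha hc).trans (digitBound_mono hj)).trans
      (Nat.le_add_left _ _)

lemma insertDigits_mul_le (hφmono : MonotoneOn φ (Ioi (0 : ℝ)))
    (ha : ∀ i, a i ≤ digitBound i) {j n : ℕ} (hj : j < n) :
    insertDigits φ a j * insertDigits φ a (j + 1) ≤ max ⌈φ n⌉₊ (digitBound n ^ 2) := by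
  by_cases h1 : IsCenter j
  · rw [insertDigits_succ_center h1, mul_one]
    exact (insertDigits_center_le hφmono hj.le h1).trans (le_max_left _ _)
  by_cases h2 : IsCenter (j + 1)
  · rw [insertDigits_of_succ_center h2, one_mul]
    exact (insertDigits_center_le hφmono hj h2).trans (le_max_left _ _)
  refine le_trans ?_ (le_max_right _ _)
  rw [sq]
  exact Nat.mul_le_mul ((insertDigits_not_center_le ha h1).trans (digitBound_mono hj.le))
    ((insertDigits_not_center_le ha h2).trans (digitBound_mono hj))

end Insert

/-- The inserted continued fraction attached to `x`. -/
noncomputable def insertMap (φ : ℝ → ℝ) (x : ℝ) : ℝ :=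
  cfVal (insertDigits φ fun i => pq x (i + 1))

section InsertMap

variable {φ : ℝ → ℝ} {x y : ℝ}

lemma isCFPoint_of_mem_tameSet (hx : x ∈ tameSet) : IsCFPoint x :=
  isCFPoint_of_irrational hx.2.1 hx.1

lemma pq_le_digitBound (hx : x ∈ tameSet) (i : ℕ) : pq x (i + 1) ≤ digitBound i := by
  have h := hx.2.2 i
  have h0 : (0 : ℝ) < digitBound i := by exact_mod_cast one_le_digitBound i
  rw [pq, Nat.add_sub_cancel]
  refine Nat.floor_le_of_le ?_
  rw [div_le_iff₀ (isCFPoint_of_mem_tameSet hx i).1]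
  rwa [div_le_iff₀ h0, mul_comm] at h

lemma one_le_insertDigits_pq (hφpos : ∀ x > (0 : ℝ), 0 < φ x) (hx : x ∈ tameSet) (j : ℕ) :
    1 ≤ insertDigits φ (fun i => pq x (i + 1)) j :=
  one_le_insertDigits hφpos (isCFPoint_of_mem_tameSet hx).one_le_pq j

lemma pq_insertMap (hφpos : ∀ x > (0 : ℝ), 0 < φ x) (hx : x ∈ tameSet) (j : ℕ) :
    pq (insertMap φ x) (j + 1) = insertDigits φ (fun i => pq x (i + 1)) j :=
  pq_cfVal (one_le_insertDigits_pq hφpos hx) j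

lemma isCFPoint_insertMap (hφpos : ∀ x > (0 : ℝ), 0 < φ x) (hx : x ∈ tameSet) :
    IsCFPoint (insertMap φ x) :=
  isCFPoint_cfVal (one_le_insertDigits_pq hφpos hx)

lemma Lmax_insertMap_le (hφpos : ∀ x > (0 : ℝ), 0 < φ x) (hφmono : MonotoneOn φ (Ioi (0 : ℝ)))
    (hx : x ∈ tameSet) (n : ℕ) :
    Lmax (insertMap φ x) n ≤ max ⌈φ n⌉₊ (digitBound n ^ 2) := by
  refine Finset.sup_le fun i hi => ?_
  obtain ⟨hi1, hin⟩ := Finset.mem_Icc.1 hi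
  obtain ⟨j, rfl⟩ : ∃ j, i = j + 1 := ⟨i - 1, by omega⟩
  rw [pq_insertMap hφpos hx, pq_insertMap hφpos hx]
  exact insertDigits_mul_le hφmono (pq_le_digitBound hx) hin

lemma le_Lmax_insertMap (hφpos : ∀ x > (0 : ℝ), 0 < φ x) (hx : x ∈ tameSet) {k n : ℕ}
    (hk : 2 ≤ k) (hkn : k ^ 2 < n) : φ ((k ^ 2 : ℕ) : ℝ) ≤ Lmax (insertMap φ x) n := by
  have hc : IsCenter (k ^ 2) := ⟨k, hk, rfl⟩
  have h : pq (insertMap φ x) (k ^ 2 + 1) * pq (insertMap φ x) (k ^ 2 + 1 + 1) ≤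
      Lmax (insertMap φ x) n :=
    Finset.le_sup (f := fun i => pq (insertMap φ x) i * pq (insertMap φ x) (i + 1))
      (Finset.mem_Icc.2 ⟨Nat.le_add_left _ _, hkn⟩)
  rw [pq_insertMap hφpos hx, pq_insertMap hφpos hx, insertDigits_succ_center hc, mul_one,
    insertDigits_center hc] at h
  exact (Nat.le_ceil _).trans (by exact_mod_cast h)

/-- The distortion of the insertion map at scale `n`. -/
lemma exists_insertMap_distortion (hφpos : ∀ x > (0 : ℝ), 0 < φ x)
    (hφmono : MonotoneOn φ (Ioi (0 : ℝ))) (hx : x ∈ tameSet) (hy : y ∈ tameSet) (hxy : x ≠ y) :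
    ∃ (n : ℕ) (q : ℝ), 2 / 3 * (3 / 2 : ℝ) ^ (n - 3 * (Nat.sqrt n + 1)) ≤ q ∧
      |x - y| ≤ 1 / q ^ 2 ∧
      1 / (4 * (insertBound φ n + 1 : ℝ) ^ (6 * Nat.sqrt n + 9) * q ^ 2) ≤
        |insertMap φ x - insertMap φ y| := by
  classical
  have hx' := isCFPoint_of_mem_tameSet hx
  have hy' := isCFPoint_of_mem_tameSet hy
  obtain ⟨m, hm, hne⟩ := hx'.exists_first_diff hy' hxy
  obtain ⟨n, hfree, hcount⟩ : ∃ n, IsFree n ∧ Nat.count IsFree n = m :=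
    ⟨Nat.nth IsFree m, Nat.nth_mem_of_infinite infinite_isFree m,
      Nat.count_nth_of_infinite infinite_isFree m⟩
  have hsub := sub_count_isFree_le n
  rw [hcount] at hsub
  refine ⟨n, cfDen (fun i => pq x (i + 1)) (m + 1), ?_, hx'.abs_sub_le hy' hm, ?_⟩
  · refine le_trans ?_ (cfDen_growth hx'.one_le_pq m)
    gcongr
    · norm_num
    · omega
  have hagree : ∀ j < n, pq (insertMap φ x) (j + 1) = pq (insertMap φ y) (j + 1) := by
    intro j hj
    rw [pq_insertMap hφpos hx, pq_insertMap hφpos hy]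
    unfold insertDigits
    split_ifs with h1 h2
    · rfl
    · exact hm _ (by rw [← hcount]; exact Nat.count_strict_mono h2 hj)
    · rfl
  have hdiff : pq (insertMap φ x) (n + 1) ≠ pq (insertMap φ y) (n + 1) := by
    rw [pq_insertMap hφpos hx, pq_insertMap hφpos hy, insertDigits_free hfree,
      insertDigits_free hfree, hcount]
    exact hne
  have hbd : ∀ {z : ℝ}, z ∈ tameSet → ∀ i ≤ n + 1, pq (insertMap φ z) (i + 1) ≤
      insertBound φ n := by
    intro z hz i hi
    rw [pq_insertMap hφpos hz]
    exact insertDigits_le hφmono (pq_le_digitBound hz) hi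
  refine le_trans ?_ ((isCFPoint_insertMap hφpos hx).le_abs_sub (isCFPoint_insertMap hφpos hy)
    hagree hdiff (hbd hx) (hbd hy))
  have hden : cfDen (fun i => pq (insertMap φ x) (i + 1)) (n + 1) ≤
      (insertBound φ n + 1) ^ (3 * (Nat.sqrt n + 1)) * cfDen (fun i => pq x (i + 1)) (m + 1) := by
    refine (cfDen_insert_le (a := fun i => pq x (i + 1)) isFree_zero (fun j hj => ?_)
      (fun i hi => ?_) (fun j hj => hbd hx j (by omega)) hx'.one_le_pq).trans ?_
    · rw [pq_insertMap hφpos hx, insertDigits_free hj]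
    · exact ((pq_le_digitBound hx i).trans (digitBound_mono (by omega))).trans
        (Nat.le_add_left _ _)
    · rw [hcount]
      gcongr
      omega
  have hq : (0 : ℝ) < cfDen (fun i => pq (insertMap φ x) (i + 1)) (n + 1) := by
    exact_mod_cast cfDen_succ_pos (isCFPoint_insertMap hφpos hx).one_le_pq n
  refine one_div_le_one_div_of_le (by positivity) ?_
  have hden' : (cfDen (fun i => pq (insertMap φ x) (i + 1)) (n + 1) : ℝ) ≤
      (insertBound φ n + 1 : ℝ) ^ (3 * (Nat.sqrt n + 1)) *
        cfDen (fun i => pq x (i + 1)) (m + 1) := by exact_mod_cast hden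
  calc _ ≤ 4 * (insertBound φ n + 1 : ℝ) ^ 3 * ((insertBound φ n + 1 : ℝ) ^
        (3 * (Nat.sqrt n + 1)) * cfDen (fun i => pq x (i + 1)) (m + 1)) ^ 2 := by gcongr
    _ = _ := by ring

end InsertMap

lemma RegInc.monotoneOn {R : ℝ → ℝ} {ρ : ℝ} (hR : RegInc R ρ) :
    ∃ c > (0 : ℝ), (∀ x ∈ Ici c, 0 < R x) ∧ MonotoneOn R (Ici c) := by
  obtain ⟨c, hc, R', hpos, hder, -, hR', -, -⟩ := hR
  refine ⟨c, hc, hpos, monotoneOn_of_hasDerivWithinAt_nonneg (convex_Ici c)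
    (fun x hx => (hder x hx).continuousAt.continuousWithinAt)
    (fun x hx => (hder x (interior_subset hx)).hasDerivWithinAt)
    fun x hx => (hR' x (interior_subset hx)).le⟩

lemma RegInc.tendsto_atTop {R : ℝ → ℝ} {ρ : ℝ} (hR : RegInc R ρ) : Tendsto R atTop atTop := by
  obtain ⟨c, hc, R', -, -, -, -, h, -⟩ := hR
  exact h

/-- Regularly increasing functions of index zero grow more slowly than any power. -/
lemma RegInc.le_rpow {R : ℝ → ℝ} (hR : RegInc R 0) {s : ℝ} (hs : 0 < s) :
    ∃ K > (0 : ℝ), ∀ᶠ x in atTop, R x ≤ K * x ^ s := by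
  obtain ⟨c, hc, R', hpos, hder, -, -, -, hlim⟩ := hR
  obtain ⟨x₀, hx₀⟩ := eventually_atTop.1 ((hlim.eventually_lt_const hs).and (eventually_ge_atTop c))
  have hcx : c ≤ x₀ := (hx₀ x₀ le_rfl).2
  have hx₀pos : 0 < x₀ := hc.trans_le hcx
  have hd : ∀ x ∈ Ici x₀, HasDerivAt (fun x => Real.log (R x) - s * Real.log x)
      (R' x / R x - s * x⁻¹) x := fun x hx =>
    ((hder x (hcx.trans hx)).log (hpos x (hcx.trans hx)).ne').sub
      ((Real.hasDerivAt_log (hx₀pos.trans_le hx).ne').const_mul s)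
  have hanti : AntitoneOn (fun x => Real.log (R x) - s * Real.log x) (Ici x₀) := by
    refine antitoneOn_of_hasDerivWithinAt_nonpos (convex_Ici x₀)
      (fun x hx => (hd x hx).continuousAt.continuousWithinAt)
      (fun x hx => (hd x (interior_subset hx)).hasDerivWithinAt) fun x hx => ?_
    have hx := interior_subset hx
    have hxpos : 0 < x := hx₀pos.trans_le hx
    have h := (hx₀ x hx).1
    have hRx := hpos x (hcx.trans hx)
    have heq : R' x / R x - s * x⁻¹ = (x * R' x / R x - s) / x := by field_simp
    rw [heq]
    exact div_nonpos_of_nonpos_of_nonneg (by linarith) hxpos.le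
  refine ⟨Real.exp (Real.log (R x₀) - s * Real.log x₀), Real.exp_pos _, ?_⟩
  filter_upwards [eventually_ge_atTop x₀] with x hx
  have hxpos : 0 < x := hx₀pos.trans_le hx
  have h : Real.log (R x) - s * Real.log x ≤ Real.log (R x₀) - s * Real.log x₀ :=
    hanti self_mem_Ici hx hx
  rw [Real.rpow_def_of_pos hxpos, ← Real.exp_add, ← Real.log_le_iff_le_exp (hpos x (hcx.trans hx))]
  linarith

section Growth

variable {R φ : ℝ → ℝ}

/-- `φ` outgrows the squares of the digit bounds. -/
lemma eventually_digitBound_sq_le (hR : RegInc R 0) (hφpos : ∀ x > (0 : ℝ), 0 < φ x)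
    (hlog : ∀ n : ℕ, 1 ≤ n → Real.log (φ n) = Real.sqrt n / R n) :
    ∀ᶠ n : ℕ in atTop, (digitBound n : ℝ) ^ 2 ≤ φ n := by
  obtain ⟨K, hK, hRK⟩ := hR.le_rpow (s := 1 / 4) (by norm_num)
  have hlittle : (fun x : ℝ => Real.log 576 + 4 * Real.log x) =o[atTop] fun x => x ^ (1 / 4 : ℝ) :=
    ((Asymptotics.isLittleO_const_left.2 <| Or.inr <| tendsto_norm_atTop_atTop.comp
      (tendsto_rpow_atTop (by norm_num))).add
      ((isLittleO_log_rpow_atTop (by norm_num)).const_mul_left 4))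
  have hb := hlittle.bound (c := 1 / K) (by positivity)
  obtain ⟨c, -, hRpos, -⟩ := hR.monotoneOn
  filter_upwards [tendsto_natCast_atTop_atTop.eventually hb,
    tendsto_natCast_atTop_atTop.eventually hRK,
    tendsto_natCast_atTop_atTop.eventually (eventually_ge_atTop c), eventually_ge_atTop 1]
    with n h1 h2 h3 h4
  have hn : (1 : ℝ) ≤ n := by exact_mod_cast h4
  have hn0 : (0 : ℝ) < n := by linarith
  have hd : (digitBound n : ℝ) ≤ 24 * (n : ℝ) ^ 2 := by
    unfold digitBound
    push_cast
    nlinarith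
  have hroot : (n : ℝ) ^ (1 / 4 : ℝ) / K ≤ Real.sqrt n / R n := by
    have hsq : Real.sqrt n = (n : ℝ) ^ (1 / 4 : ℝ) * (n : ℝ) ^ (1 / 4 : ℝ) := by
      rw [← Real.rpow_add hn0, Real.sqrt_eq_rpow]
      norm_num
    have hp : 0 < (n : ℝ) ^ (1 / 4 : ℝ) := by positivity
    rw [div_le_div_iff₀ hK (hRpos _ h3), hsq]
    nlinarith [mul_le_mul_of_nonneg_left h2 hp.le]
  rw [Real.norm_eq_abs, Real.norm_eq_abs, abs_of_pos (a := (n : ℝ) ^ (1 / 4 : ℝ)) (by positivity)]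
    at h1
  have hφn := hφpos n hn0
  calc (digitBound n : ℝ) ^ 2 ≤ (24 * (n : ℝ) ^ 2) ^ 2 := by gcongr
    _ = Real.exp (Real.log 576 + 4 * Real.log n) := by
      rw [Real.exp_add, Real.exp_log (by norm_num), mul_comm (4 : ℝ), Real.exp_mul,
        Real.exp_log hn0]
      norm_cast
      ring
    _ ≤ Real.exp (Real.log (φ n)) := by
      rw [hlog n h4]
      refine Real.exp_le_exp.2 (le_trans ((le_abs_self _).trans h1) ?_)
      rw [one_div_mul_eq_div]
      exact hroot
    _ = φ n := Real.exp_log hφn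

lemma natCast_le_digitBound (n : ℕ) : (n : ℝ) ≤ (digitBound n : ℝ) ^ 2 := by
  have h : n ≤ digitBound n ^ 2 := by
    have : n ≤ digitBound n := by
      unfold digitBound
      nlinarith
    exact this.trans (Nat.le_self_pow two_ne_zero _)
  exact_mod_cast h

lemma tendsto_nat_atTop (hR : RegInc R 0) (hφpos : ∀ x > (0 : ℝ), 0 < φ x)
    (hlog : ∀ n : ℕ, 1 ≤ n → Real.log (φ n) = Real.sqrt n / R n) :
    Tendsto (fun n : ℕ => φ n) atTop atTop := by
  refine tendsto_atTop_mono' _ ?_ tendsto_natCast_atTop_atTop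
  filter_upwards [eventually_digitBound_sq_le hR hφpos hlog] with n hn
  exact (natCast_le_digitBound n).trans hn

lemma exp_le_div_of_sq (hR : RegInc R 0) (hφpos : ∀ x > (0 : ℝ), 0 < φ x)
    (hlog : ∀ n : ℕ, 1 ≤ n → Real.log (φ n) = Real.sqrt n / R n) :
    ∀ᶠ n : ℕ in atTop, Real.exp (-(2 / R (((Nat.sqrt n - 1) ^ 2 : ℕ) : ℝ))) ≤
      φ (((Nat.sqrt n - 1) ^ 2 : ℕ) : ℝ) / φ n := by
  obtain ⟨c, -, hRpos, hmono⟩ := hR.monotoneOn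
  obtain ⟨N, hN⟩ := exists_nat_ge c
  filter_upwards [eventually_ge_atTop ((N + 2) ^ 2)] with n hn
  have hs : N + 2 ≤ Nat.sqrt n := Nat.le_sqrt'.2 hn
  obtain ⟨k, hk⟩ : ∃ k, Nat.sqrt n = k + 1 := ⟨Nat.sqrt n - 1, by omega⟩
  rw [hk, Nat.add_sub_cancel]
  have hkN : N + 1 ≤ k := by omega
  have hkn : k ^ 2 ≤ n := by
    have := Nat.sqrt_le' n
    rw [hk] at this
    nlinarith
  have hnk : n < (k + 2) ^ 2 := by
    have := Nat.lt_succ_sqrt' n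
    rwa [hk] at this
  have hck : c ≤ ((k ^ 2 : ℕ) : ℝ) := hN.trans (by exact_mod_cast (by nlinarith : N ≤ k ^ 2))
  have hkn' : ((k ^ 2 : ℕ) : ℝ) ≤ n := by exact_mod_cast hkn
  have hRk := hRpos _ hck
  have hRn := hmono hck (hck.trans hkn') hkn'
  have hk2 : 1 ≤ k ^ 2 := Nat.one_le_pow _ _ (by omega)
  have hφk := hφpos ((k ^ 2 : ℕ) : ℝ) (by exact_mod_cast hk2)
  have hφn := hφpos n (by exact_mod_cast hk2.trans hkn)
  rw [← Real.log_le_log_iff (Real.exp_pos _) (by positivity), Real.log_exp,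
    Real.log_div hφk.ne' hφn.ne', hlog _ hk2, hlog _ (hk2.trans hkn)]
  have hsqk : Real.sqrt ((k ^ 2 : ℕ) : ℝ) = k := by
    push_cast
    exact Real.sqrt_sq (Nat.cast_nonneg _)
  have hsqn : Real.sqrt n ≤ k + 2 := by
    rw [Real.sqrt_le_left (by positivity)]
    exact_mod_cast hnk.le
  rw [hsqk]
  have h1 : Real.sqrt n / R n ≤ (k + 2) / R ((k ^ 2 : ℕ) : ℝ) := by gcongr
  have h2 : ((k : ℝ) + 2) / R ((k ^ 2 : ℕ) : ℝ) =
      k / R ((k ^ 2 : ℕ) : ℝ) + 2 / R ((k ^ 2 : ℕ) : ℝ) := add_div _ _ _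
  linarith

lemma tendsto_Lmax_insertMap (hR : RegInc R 0) (hφpos : ∀ x > (0 : ℝ), 0 < φ x)
    (hφmono : MonotoneOn φ (Ioi (0 : ℝ)))
    (hlog : ∀ n : ℕ, 1 ≤ n → Real.log (φ n) = Real.sqrt n / R n) {x : ℝ} (hx : x ∈ tameSet) :
    Tendsto (fun n : ℕ => (Lmax (insertMap φ x) n : ℝ) / φ n) atTop (nhds 1) := by
  have hsqrt : Tendsto (fun n : ℕ => (((Nat.sqrt n - 1) ^ 2 : ℕ) : ℝ)) atTop atTop := by
    refine tendsto_natCast_atTop_atTop.comp (tendsto_atTop_atTop.2 fun b => ⟨(b + 1) ^ 2, ?_⟩)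
    intro n hn
    have h : b + 1 ≤ Nat.sqrt n := Nat.le_sqrt'.2 hn
    exact (Nat.le_sub_of_add_le h).trans (Nat.le_self_pow two_ne_zero _)
  have hlow : Tendsto (fun n : ℕ => Real.exp (-(2 / R (((Nat.sqrt n - 1) ^ 2 : ℕ) : ℝ))))
      atTop (nhds 1) := by
    have h0 : Tendsto (fun n : ℕ => -(2 / R (((Nat.sqrt n - 1) ^ 2 : ℕ) : ℝ))) atTop (nhds 0) := by
      simpa using ((hR.tendsto_atTop.comp hsqrt).const_div_atTop 2).neg
    have h := (Real.continuous_exp.tendsto 0).comp h0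
    rwa [Real.exp_zero] at h
  have hφtop := tendsto_nat_atTop hR hφpos hlog
  have hup : Tendsto (fun n : ℕ => 1 + 1 / φ n) atTop (nhds 1) := by
    simpa using (hφtop.const_div_atTop 1).const_add 1
  refine tendsto_of_tendsto_of_tendsto_of_le_of_le' hlow hup ?_ ?_
  · filter_upwards [exp_le_div_of_sq hR hφpos hlog, eventually_ge_atTop (3 ^ 2)] with n h hn
    have hs : 3 ≤ Nat.sqrt n := Nat.le_sqrt'.2 hn
    have hφn := hφpos n (by exact_mod_cast (by omega : 0 < n))
    refine h.trans ?_
    gcongr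
    refine le_Lmax_insertMap hφpos hx (by omega) ?_
    calc (Nat.sqrt n - 1) ^ 2 < Nat.sqrt n ^ 2 := Nat.pow_lt_pow_left (by omega) two_ne_zero
      _ ≤ n := Nat.sqrt_le' n
  · filter_upwards [eventually_digitBound_sq_le hR hφpos hlog, eventually_ge_atTop 1] with n h hn
    have hφn := hφpos n (by exact_mod_cast hn)
    rw [div_le_iff₀ hφn, add_mul, one_mul, one_div_mul_cancel hφn.ne']
    have hL : (Lmax (insertMap φ x) n : ℝ) ≤ max (⌈φ n⌉₊ : ℝ) ((digitBound n : ℝ) ^ 2) := by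
      exact_mod_cast Lmax_insertMap_le hφpos hφmono hx n
    exact hL.trans (max_le (Nat.ceil_lt_add_one hφn.le).le (by linarith))

/-- The logarithmic distortion of the insertion map at scale `n` is `o(n)`. -/
lemma exists_log_distortion_le (hR : RegInc R 0) (hφpos : ∀ x > (0 : ℝ), 0 < φ x)
    (hlog : ∀ n : ℕ, 1 ≤ n → Real.log (φ n) = Real.sqrt n / R n) {κ : ℝ} (hκ : 0 < κ) :
    ∃ C : ℝ, ∀ n : ℕ, Real.log 4 + (6 * Nat.sqrt n + 9 : ℕ) * Real.log (insertBound φ n + 1 : ℝ) ≤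
      C + κ * (n - 3 * (Nat.sqrt n + 1) : ℕ) := by
  have hφtop := tendsto_nat_atTop hR hφpos hlog
  have hev : ∀ᶠ n : ℕ in atTop, Real.log 4 +
      (6 * Nat.sqrt n + 9 : ℕ) * Real.log (insertBound φ n + 1 : ℝ) -
      κ * (n - 3 * (Nat.sqrt n + 1) : ℕ) ≤ Real.log 4 + 8 * κ := by
    have hRev : ∀ᶠ n : ℕ in atTop, 180 / κ ≤ R ((n + 1 : ℕ) : ℝ) :=
      ((hR.tendsto_atTop.comp tendsto_natCast_atTop_atTop).comp
        (tendsto_add_atTop_nat 1)).eventually_ge_atTop _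
    filter_upwards [(tendsto_add_atTop_nat 1).eventually
      (eventually_digitBound_sq_le hR hφpos hlog),
      (hφtop.comp (tendsto_add_atTop_nat 1)).eventually_ge_atTop 4, hRev,
      eventually_ge_atTop 1] with n h1 h2 h3 h4
    have hn : (1 : ℝ) ≤ n := by exact_mod_cast h4
    set Φ := φ ((n + 1 : ℕ) : ℝ) with hΦ
    have h2' : (4 : ℝ) ≤ Φ := h2
    have hd1 : (1 : ℝ) ≤ digitBound (n + 1) := by exact_mod_cast one_le_digitBound _
    have hB : (insertBound φ n + 1 : ℝ) ≤ Φ ^ 3 := by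
      have hceil := (Nat.ceil_lt_add_one (by linarith : 0 ≤ Φ)).le
      have hcast : (insertBound φ n : ℝ) = ⌈Φ⌉₊ + digitBound (n + 1) := by
        rw [insertBound, Nat.cast_add]
      have hd2 : (digitBound (n + 1) : ℝ) ≤ Φ := by nlinarith
      rw [hcast]
      nlinarith [sq_nonneg Φ, mul_nonneg (sq_nonneg Φ) (by linarith : 0 ≤ Φ - 4)]
    have hlogB : Real.log (insertBound φ n + 1 : ℝ) ≤
        3 * (Real.sqrt ((n + 1 : ℕ) : ℝ) / R ((n + 1 : ℕ) : ℝ)) := by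
      rw [← hlog (n + 1) (by omega)]
      calc _ ≤ Real.log (Φ ^ 3) := Real.log_le_log (by positivity) hB
        _ = _ := by rw [Real.log_pow, Nat.cast_ofNat]
    have hs : (Nat.sqrt n : ℝ) ≤ Real.sqrt n := Real.nat_sqrt_le_real_sqrt
    have hs1 : 1 ≤ Real.sqrt n := Real.one_le_sqrt.2 hn
    have hsq : Real.sqrt n * Real.sqrt n = n := Real.mul_self_sqrt (by linarith)
    have hsqrt : Real.sqrt ((n + 1 : ℕ) : ℝ) ≤ 2 * Real.sqrt n := by
      rw [Real.sqrt_le_left (by positivity)]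
      push_cast
      nlinarith
    have hRpos : 0 < R ((n + 1 : ℕ) : ℝ) := lt_of_lt_of_le (by positivity) h3
    have hmain : ((6 * Nat.sqrt n + 9 : ℕ) : ℝ) * Real.log (insertBound φ n + 1 : ℝ) ≤
        κ / 2 * n := by
      have hB0 : 0 ≤ Real.log (insertBound φ n + 1 : ℝ) :=
        Real.log_nonneg (le_add_of_nonneg_left (Nat.cast_nonneg _))
      calc ((6 * Nat.sqrt n + 9 : ℕ) : ℝ) * Real.log (insertBound φ n + 1 : ℝ)
          ≤ (15 * Real.sqrt n) * (3 * (2 * Real.sqrt n / (180 / κ))) := by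
            refine mul_le_mul ?_ (hlogB.trans ?_) hB0 (by positivity)
            · push_cast
              linarith
            · gcongr
        _ = κ / 2 * (Real.sqrt n * Real.sqrt n) := by field_simp; norm_num
        _ = κ / 2 * n := by rw [hsq]
    have hsub : (n : ℝ) - 3 * (Real.sqrt n + 1) ≤ ((n - 3 * (Nat.sqrt n + 1) : ℕ) : ℝ) := by
      have h : n ≤ (n - 3 * (Nat.sqrt n + 1)) + 3 * (Nat.sqrt n + 1) := le_tsub_add
      have h' : (n : ℝ) ≤ ((n - 3 * (Nat.sqrt n + 1) : ℕ) : ℝ) + 3 * (Nat.sqrt n + 1) := by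
        exact_mod_cast h
      linarith
    have hamgm : 3 * Real.sqrt n ≤ n / 2 + 9 / 2 := by nlinarith [sq_nonneg (Real.sqrt n - 3)]
    have hκsub := mul_le_mul_of_nonneg_left hsub hκ.le
    have hκamgm := mul_le_mul_of_nonneg_left hamgm hκ.le
    linarith
  obtain ⟨C, hC⟩ := (isBoundedUnder_of_eventually_le hev).bddAbove_range
  refine ⟨C, fun n => ?_⟩
  have := hC (mem_range_self n)
  linarith

lemma exists_abs_sub_le_insertMap (hR : RegInc R 0) (hφpos : ∀ x > (0 : ℝ), 0 < φ x)
    (hφmono : MonotoneOn φ (Ioi (0 : ℝ)))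
    (hlog : ∀ n : ℕ, 1 ≤ n → Real.log (φ n) = Real.sqrt n / R n) {r : ℝ} (hr0 : 0 < r)
    (hr1 : r < 1) :
    ∃ C > (0 : ℝ), ∀ x ∈ tameSet, ∀ y ∈ tameSet,
      |x - y| ≤ C * |insertMap φ x - insertMap φ y| ^ r := by
  have hε : 0 < r⁻¹ - 1 := sub_pos.2 ((one_lt_inv₀ hr0).2 hr1)
  set ε := r⁻¹ - 1 with hεdef
  have hlog32 : 0 < Real.log (3 / 2) := Real.log_pos (by norm_num)
  obtain ⟨C, hC⟩ := exists_log_distortion_le hR hφpos hlog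
    (by positivity : 0 < 2 * ε * Real.log (3 / 2))
  set A := Real.exp (C - 2 * ε * Real.log (2 / 3)) with hA
  have hApos : 0 < A := Real.exp_pos _
  refine ⟨A ^ r, Real.rpow_pos_of_pos hApos _, fun x hx y hy => ?_⟩
  by_cases hxy : x = y
  · subst hxy
    simp only [sub_self, abs_zero]
    positivity
  obtain ⟨n, q, hq, hle, hge⟩ := exists_insertMap_distortion hφpos hφmono hx hy hxy
  have hqpos : 0 < q := lt_of_lt_of_le (by positivity) hq
  have hD : 4 * (insertBound φ n + 1 : ℝ) ^ (6 * Nat.sqrt n + 9) ≤ A * q ^ (2 * ε) := by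
    have hlogq : Real.log (2 / 3) + (n - 3 * (Nat.sqrt n + 1) : ℕ) * Real.log (3 / 2) ≤
        Real.log q := by
      rw [← Real.log_pow, ← Real.log_mul (by norm_num) (by positivity)]
      exact Real.log_le_log (by positivity) hq
    rw [← Real.log_le_log_iff (by positivity) (by positivity), Real.log_mul (by norm_num)
      (by positivity), Real.log_pow, Real.log_mul hApos.ne' (by positivity), Real.log_rpow hqpos,
      hA, Real.log_exp]
    have h1 := hC n
    have h2 := mul_le_mul_of_nonneg_left hlogq (by positivity : 0 ≤ 2 * ε)
    linarith
  have hP : (A * q ^ (2 / r))⁻¹ ≤ |insertMap φ x - insertMap φ y| := by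
    refine le_trans ?_ hge
    rw [← one_div]
    refine one_div_le_one_div_of_le (by positivity) ?_
    calc _ ≤ A * q ^ (2 * ε) * q ^ 2 := by gcongr
      _ = A * q ^ (2 / r) := by
        rw [mul_assoc, ← Real.rpow_natCast q 2, ← Real.rpow_add hqpos, hεdef]
        congr 2
        push_cast
        ring
  calc |x - y| ≤ 1 / q ^ 2 := hle
    _ = A ^ r * ((A * q ^ (2 / r))⁻¹) ^ r := by
      rw [← Real.mul_rpow hApos.le (by positivity), mul_inv, mul_inv_cancel_left₀ hApos.ne',
        Real.inv_rpow (by positivity), ← Real.rpow_mul hqpos.le, div_mul_cancel₀ _ hr0.ne',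
        one_div]
      norm_cast
    _ ≤ A ^ r * |insertMap φ x - insertMap φ y| ^ r := by gcongr

end Growth

/-- If `f` does not contract distances on `s` too strongly, then the dimension of `f '' s` is
controlled from below by the dimension of `s`. -/
lemma mul_dimH_le_dimH_image {f : ℝ → ℝ} {s : Set ℝ} {C r : ℝ} (hC : 0 ≤ C) (hr : 0 < r)
    (h : ∀ x ∈ s, ∀ y ∈ s, |x - y| ≤ C * |f x - f y| ^ r) :
    ENNReal.ofReal r * dimH s ≤ dimH (f '' s) := by
  have hinj : InjOn f s := fun x hx y hy hxy => by
    have h0 := h x hx y hy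
    rw [hxy, sub_self, abs_zero, Real.zero_rpow hr.ne', mul_zero] at h0
    exact sub_eq_zero.1 (abs_nonpos_iff.1 h0)
  have hhol : HolderOnWith C.toNNReal r.toNNReal (Function.invFunOn f s) (f '' s) := by
    rintro _ ⟨x, hx, rfl⟩ _ ⟨y, hy, rfl⟩
    rw [hinj.leftInvOn_invFunOn hx, hinj.leftInvOn_invFunOn hy, edist_dist, edist_dist,
      Real.coe_toNNReal r hr.le, ENNReal.ofReal_rpow_of_nonneg dist_nonneg hr.le]
    change _ ≤ ENNReal.ofReal C * _
    rw [← ENNReal.ofReal_mul hC]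
    exact ENNReal.ofReal_le_ofReal (h x hx y hy)
  have hdim := hhol.dimH_image_le (Real.toNNReal_pos.2 hr)
  rw [hinj.invFunOn_image Subset.rfl] at hdim
  rw [mul_comm]
  exact ENNReal.mul_le_of_le_div hdim

/-- Theorem 1.3, first case: if `R` is regularly increasing with index `0` and
`log φ(n) = √n / R(n)`, then `dim_H L(φ) = 1`. -/
theorem statement3 (R φ : ℝ → ℝ)
    (hR : RegInc R 0)
    (hφpos : ∀ x > (0 : ℝ), 0 < φ x)
    (hφmono : MonotoneOn φ (Ioi (0 : ℝ)))
    (hlog : ∀ n : ℕ, 1 ≤ n → Real.log (φ n) = Real.sqrt n / R n) :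
    dimH (Lset fun n : ℕ => φ n) = 1 := by
  refine le_antisymm ((dimH_mono (subset_univ _)).trans Real.dimH_univ.le) ?_
  have hsub : insertMap φ '' tameSet ⊆ (Lset fun n : ℕ => φ n) ∪ range ((↑) : ℚ → ℝ) := by
    rintro _ ⟨x, hx, rfl⟩
    by_cases hirr : Irrational (insertMap φ x)
    · exact Or.inl ⟨isCFPoint_insertMap hφpos hx 0, hirr,
        tendsto_Lmax_insertMap hR hφpos hφmono hlog hx⟩
    · exact Or.inr (by simpa [Irrational] using hirr)
  have hdim : dimH (insertMap φ '' tameSet) ≤ dimH (Lset fun n : ℕ => φ n) := by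
    refine (dimH_mono hsub).trans ?_
    rw [dimH_union, (countable_range _).dimH_zero]
    simp
  refine le_of_forall_lt_imp_le_of_dense fun c hc => ?_
  lift c to NNReal using hc.ne_top
  rcases eq_zero_or_pos c with rfl | hc0
  · simp
  obtain ⟨C, hC, h⟩ := exists_abs_sub_le_insertMap hR hφpos hφmono hlog (r := c) hc0
    (by exact_mod_cast hc)
  calc (c : ℝ≥0∞) = ENNReal.ofReal c * 1 := by simp
    _ ≤ ENNReal.ofReal c * dimH tameSet := by gcongr; exact one_le_dimH_tameSet
    _ ≤ dimH (insertMap φ '' tameSet) := mul_dimH_le_dimH_image hC.le hc0 h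
    _ ≤ _ := hdim
end
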